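/- arXiv:0804.3963 — 3 statements merged into one kernel-verified Lean document; each statement's English description precedes it below -/
import Mathlib

section
/- Let (W,S) be a Coxeter system with finite S, and suppose W contains no free subgroup of rank 2. If a, b ∈ S are unrelated (m(a,b) = ∞), then both a and b commute with every element of S − {a,b}, and W decomposes as the direct product ⟨a,b⟩ × ⟨S − {a,b}⟩. -/
universe u

open Polynomial.Chebyshev in
/-- The product of two reflections whose associated pairing numbers are `-2 * cos (π / m)` has
order dividing `m`. -/
theorem Module.reflection_mul_reflection_pow_eq_one {V : Type*} [AddCommGroup V] [Module ℝ V]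
    {x y : V} {f g : Module.Dual ℝ V} (hf : f x = 2) (hg : g y = 2) {m : ℕ} (hm : 2 ≤ m)
    (hfy : f y = -2 * Real.cos (Real.pi / m)) (hgx : g x = -2 * Real.cos (Real.pi / m)) :
    (Module.reflection hf * Module.reflection hg) ^ m = 1 := by
  rcases hm.eq_or_lt with rfl | hm
  · have hfy : f y = 0 := by simp [hfy]
    have hgx : g x = 0 := by simp [hgx]
    ext z
    simp only [pow_two, LinearEquiv.mul_apply, Module.reflection_apply, map_sub, map_smul, hf, hg,
      hfy, hgx, LinearEquiv.coe_one, id_eq]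
    module
  have hm0 : (0 : ℝ) < m := by positivity
  set θ : ℝ := 2 * (Real.pi / m) with hθ
  have hmθ : m * θ = 2 * Real.pi := by rw [hθ]; field_simp
  have ht : f y * g x - 2 = 2 * Real.cos θ := by
    rw [hfy, hgx, hθ, Real.cos_two_mul]; ring
  have hsin : Real.sin θ ≠ 0 := by
    have h3 : (3 : ℝ) ≤ m := by exact_mod_cast hm
    refine (Real.sin_pos_of_pos_of_lt_pi (by positivity) ?_).ne'
    nlinarith [Real.pi_pos]
  have hS (k : ℤ) : (S ℝ k).eval (2 * Real.cos θ) * Real.sin θ = Real.sin ((k + 1) * θ) :=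
    S_two_mul_real_cos θ k
  ext z
  rw [Module.reflection_mul_reflection_pow_apply hf hg m z _ ht.symm]
  rcases Nat.even_or_odd' m with ⟨k, rfl | rfl⟩
  · have h0 : (S ℝ ((k : ℤ) - 1)).eval (2 * Real.cos θ) = 0 := by
      refine (mul_eq_zero.mp ((hS _).trans ?_)).resolve_right hsin
      rw [← Real.sin_pi]
      congr 1
      push_cast at hmθ ⊢
      linarith
    have e1 : (((2 * k : ℕ) : ℤ) - 2) / 2 = k - 1 := by omega
    have e2 : (((2 * k : ℕ) : ℤ) - 1) / 2 = k - 1 := by omega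
    rw [e1, e2, h0]
    simp
  · have h0 : (S ℝ (k : ℤ)).eval (2 * Real.cos θ) + (S ℝ ((k : ℤ) - 1)).eval (2 * Real.cos θ)
        = 0 := by
      refine (mul_eq_zero.mp (?_ : _ * Real.sin θ = 0)).resolve_right hsin
      have e : ((((k : ℤ) - 1 : ℤ) : ℝ) + 1) * θ = 2 * Real.pi - (((k : ℤ) : ℝ) + 1) * θ := by
        push_cast at hmθ ⊢
        linarith
      rw [add_mul, hS, hS, e, Real.sin_two_pi_sub]
      ring
    have e1 : (((2 * k + 1 : ℕ) : ℤ) - 1) / 2 = k := by omega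
    have e2 : (((2 * k + 1 : ℕ) : ℤ) - 3) / 2 = k - 1 := by omega
    have e3 : (((2 * k + 1 : ℕ) : ℤ)) / 2 = k := by omega
    have e4 : (((2 * k + 1 : ℕ) : ℤ) - 2) / 2 = k - 1 := by omega
    rw [e1, e2, e3, e4, h0]
    simp

namespace CoxeterMatrix

variable {B : Type*} (M : CoxeterMatrix B)

/-- The simple coroot at `i` in the geometric representation of a Coxeter matrix. -/
noncomputable def coroot (i : B) : Module.Dual ℝ (B →₀ ℝ) :=
  Finsupp.linearCombination ℝ fun j ↦ -2 * Real.cos (Real.pi / M i j)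

theorem coroot_single (i j : B) :
    M.coroot i (Finsupp.single j 1) = -2 * Real.cos (Real.pi / M i j) := by
  simp [coroot]

theorem coroot_single_self (i : B) : M.coroot i (Finsupp.single i 1) = 2 := by
  simp [coroot_single]

theorem isLiftable_reflection :
    M.IsLiftable fun i ↦ Module.reflection (M.coroot_single_self i) := by
  intro i j
  by_cases hij : i = j
  · subst hij
    ext1 z
    simpa using Module.involutive_reflection (M.coroot_single_self i) z
  by_cases h0 : M i j = 0
  · rw [h0, pow_zero]
  have h1 := M.off_diagonal i j hij
  refine Module.reflection_mul_reflection_pow_eq_one _ _ (by omega) (M.coroot_single i j) ?_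
  rw [M.coroot_single j i, M.symmetric j i]

end CoxeterMatrix

namespace CoxeterSystem

variable {B W : Type*} [Group W] {M : CoxeterMatrix B} (cs : CoxeterSystem M W)

/-- The geometric representation of a Coxeter group. -/
noncomputable def geometricRep : W →* ((B →₀ ℝ) ≃ₗ[ℝ] (B →₀ ℝ)) :=
  cs.lift ⟨_, M.isLiftable_reflection⟩

theorem geometricRep_simple (i : B) (v : B →₀ ℝ) :
    cs.geometricRep (cs.simple i) v = v - M.coroot i v • Finsupp.single i 1 := by
  rw [geometricRep, lift_apply_simple, Module.reflection_apply]

/-- The visual subgroup generated by all simple reflections except the one at `a`. -/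
def deleted (a : B) : Subgroup W :=
  Subgroup.closure (cs.simple '' {i | i ≠ a})

theorem simple_mem_deleted {a i : B} (h : i ≠ a) : cs.simple i ∈ cs.deleted a :=
  Subgroup.subset_closure ⟨i, h, rfl⟩

theorem geometricRep_apply_of_mem_deleted {a : B} {w : W} (hw : w ∈ cs.deleted a)
    (v : B →₀ ℝ) : cs.geometricRep w v a = v a := by
  induction hw using Subgroup.closure_induction generalizing v with
  | mem x hx =>
    obtain ⟨i, hi, rfl⟩ := hx
    simp [geometricRep_simple, Finsupp.single_eq_of_ne' hi]
  | one => simp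
  | mul x y _ _ hx hy => rw [map_mul, LinearEquiv.mul_apply, hx, hy]
  | inv x _ hx => rw [← hx, ← LinearEquiv.mul_apply, ← map_mul]; simp

theorem simple_notMem_deleted (a : B) : cs.simple a ∉ cs.deleted a := by
  intro h
  have := cs.geometricRep_apply_of_mem_deleted h (Finsupp.single a 1)
  simp [geometricRep_simple, M.coroot_single_self] at this

/-- If `a` and `c` do not commute, then conjugating `c` by `a` leaves the visual subgroup that
omits `a`. -/
theorem simple_conj_notMem_deleted {a c : B} (hca : c ≠ a) (h2 : M a c ≠ 2) :
    cs.simple a * cs.simple c * cs.simple a ∉ cs.deleted a := by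
  intro h
  have h := cs.geometricRep_apply_of_mem_deleted h (Finsupp.single a 1)
  have hcos : Real.cos (Real.pi / M a c) ≠ 0 := by
    by_cases h0 : M a c = 0
    · simp [h0]
    have h1 := M.off_diagonal a c hca.symm
    have h3 : (3 : ℝ) ≤ M a c := by exact_mod_cast (by omega : 3 ≤ M a c)
    have hpi := Real.pi_pos
    refine (Real.cos_pos_of_mem_Ioo ⟨?_, ?_⟩).ne'
    · linarith [show 0 < Real.pi / M a c by positivity]
    · exact div_lt_div_of_pos_left hpi two_pos (by linarith)
  simp only [map_mul, LinearEquiv.mul_apply, geometricRep_simple, map_sub, map_smul,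
    M.coroot_single, M.diagonal, M.symmetric c a, Finsupp.sub_apply, Finsupp.smul_apply,
    Finsupp.single_eq_same, Finsupp.single_eq_of_ne' hca, smul_eq_mul] at h
  simp at h
  apply hcos
  have : Real.cos (Real.pi / M a c) ^ 2 = 0 := by linarith
  simpa using this

/-- The splitting of a Coxeter group as an amalgamated product over two unrelated generators,
in the form of an action on normal words. -/
theorem exists_action_of_eq_zero {B : Type*} {W : Type u} [Group W] {M : CoxeterMatrix B}
    (cs : CoxeterSystem M W) {a b : B} (hab : a ≠ b) (hinf : M a b = 0) :
    ∃ (α : Type u) (_ : MulAction W α) (P Q : Set α), Disjoint P Q ∧ (∃ x, x ∉ P ∧ x ∉ Q) ∧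
      (∀ w ∈ cs.deleted b, w ∉ cs.deleted a → ∀ x ∉ P, w • x ∈ P) ∧
      (∀ w ∈ cs.deleted a, w ∉ cs.deleted b → ∀ x ∉ Q, w • x ∈ Q) := by
  classical
  let e : Bool → B := fun k ↦ bif k then a else b
  let H : Subgroup W := cs.deleted a ⊓ cs.deleted b
  have hH (k : Bool) : H ≤ cs.deleted (e k) := by
    cases k
    exacts [inf_le_right, inf_le_left]
  let φ (k : Bool) : H →* cs.deleted (e k) := Subgroup.inclusion (hH k)
  have hφ (k : Bool) : Function.Injective (φ k) := Subgroup.inclusion_injective (hH k)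
  let f : B → Monoid.PushoutI φ := fun i ↦
    if h : i = b then .of true ⟨cs.simple i, cs.simple_mem_deleted (h.trans_ne hab.symm)⟩
    else .of false ⟨cs.simple i, cs.simple_mem_deleted h⟩
  have hf (k : Bool) (i : B) (hi : i ≠ e k) :
      f i = .of k ⟨cs.simple i, cs.simple_mem_deleted hi⟩ := by
    cases k
    · exact dif_neg hi
    · by_cases h : i = b
      · exact dif_pos h
      · let z : H := ⟨cs.simple i, cs.simple_mem_deleted hi, cs.simple_mem_deleted h⟩
        calc f i = .of false (φ false z) := dif_neg h
          _ = .of true (φ true z) := by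
            rw [Monoid.PushoutI.of_apply_eq_base, Monoid.PushoutI.of_apply_eq_base]
  have hlift : M.IsLiftable f := by
    intro i j
    by_cases h0 : M i j = 0
    · rw [h0, pow_zero]
    obtain ⟨k, hi, hj⟩ : ∃ k, i ≠ e k ∧ j ≠ e k := by
      by_contra! hk
      have hf' := hk false
      have ht := hk true
      simp only [e, cond_true, cond_false] at hf' ht
      have hba := M.symmetric b a ▸ hinf
      by_cases hia : i = a
      · exact h0 (hia ▸ hf' (hia ▸ hab) ▸ hinf)
      · obtain rfl := ht hia
        exact h0 (by_contra (fun h ↦ hab (hf' h)) ▸ hba)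
    rw [hf k i hi, hf k j hj, ← map_mul, ← map_pow]
    exact (congrArg _ (Subtype.ext (cs.simple_mul_simple_pow i j))).trans (map_one _)
  let Φ : W →* Monoid.PushoutI φ := cs.lift ⟨f, hlift⟩
  have hΦ (k : Bool) (w : W) (hw : w ∈ cs.deleted (e k)) : Φ w = .of k ⟨w, hw⟩ := by
    induction hw using Subgroup.closure_induction with
    | mem x hx =>
      obtain ⟨i, hi, rfl⟩ := hx
      exact (cs.lift_apply_simple hlift i).trans (hf k i hi)
    | one => exact (map_one _).trans (map_one _).symm
    | mul x y hx hy ihx ihy => rw [map_mul, ihx, ihy, ← map_mul]; rfl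
    | inv x hx ihx => rw [map_inv, ihx, ← map_inv]; rfl
  obtain ⟨d⟩ := Monoid.PushoutI.NormalWord.transversal_nonempty φ hφ
  let _ : MulAction W (Monoid.PushoutI.NormalWord d) := MulAction.compHom _ Φ
  let P (k : Bool) : Set (Monoid.PushoutI.NormalWord d) := {x | x.fstIdx = some k}
  have hP (k : Bool) (w : W) (hw : w ∈ cs.deleted (e k)) (hw' : w ∉ H)
      (x : Monoid.PushoutI.NormalWord d) (hx : x ∉ P k) : w • x ∈ P k := by
    have hr : (⟨w, hw⟩ : cs.deleted (e k)) ∉ (φ k).range := by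
      rintro ⟨z, hz⟩
      have hzw : (z : W) = w := congrArg Subtype.val hz
      exact hw' (hzw ▸ z.2)
    change Φ w • x ∈ P k
    rw [hΦ k w hw, ← Monoid.PushoutI.NormalWord.cons_eq_smul _ x hx hr]
    rfl
  refine ⟨_, inferInstance, P false, P true, ?_, ⟨Monoid.PushoutI.NormalWord.empty, ?_, ?_⟩, ?_, ?_⟩
  · rw [Set.disjoint_left]
    intro x hx hx'
    have := hx.symm.trans hx'
    simp at this
  · exact fun h ↦ by cases h
  · exact fun h ↦ by cases h
  · exact fun w hw hw' ↦ hP false w hw fun h ↦ hw' h.1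
  · exact fun w hw hw' ↦ hP true w hw fun h ↦ hw' h.2

end CoxeterSystem

open scoped Pointwise in
/-- Ping-pong for three involutions: if `p`, `q`, `r` play ping-pong, then `p * q` and `p * r`
freely generate a free group. -/
theorem FreeGroup.injective_lift_of_involutions {G : Type u} {α : Type*} [Group G] [MulAction G α]
    {p q r : G} (hp : p * p = 1) (hq : q * q = 1) (hr : r * r = 1) {P Q R : Set α}
    (hPQ : Disjoint P Q) (hPR : Disjoint P R) (hQR : Disjoint Q R)
    (hQ : Q.Nonempty) (hR : R.Nonempty) (hpP : ∀ x ∉ P, p • x ∈ P)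
    (hqQ : ∀ x ∉ Q, q • x ∈ Q) (hrR : ∀ x ∉ R, r • x ∈ R) :
    Function.Injective (FreeGroup.lift ![p * q, p * r]) := by
  have hp' (x : α) : p • p • x = x := by rw [← mul_smul, hp, one_smul]
  have hsub {T : Set α} (hT : Disjoint P T) : p • T ⊆ P := by
    rintro _ ⟨x, hx, rfl⟩
    exact hpP x (hT.notMem_of_mem_right hx)
  have hd : Disjoint (p • Q) (p • R) := Set.disjoint_smul_set.mpr hQR
  have hcomp : FreeGroup.lift ![p * q, p * r] =
      (FreeGroup.lift fun i : ULift.{u} (Fin 2) ↦ ![p * q, p * r] i.down).comp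
        (FreeGroup.freeGroupCongr Equiv.ulift.symm).toMonoidHom := by
    ext i
    simp
  rw [hcomp, MonoidHom.coe_comp]
  refine Function.Injective.comp ?_ (MulEquiv.injective _)
  apply FreeGroup.injective_lift_of_ping_pong _ (fun i ↦ ![p • Q, p • R] i.down)
    (fun i ↦ ![Q, R] i.down)
  · rintro ⟨i⟩
    fin_cases i
    exacts [hQ.smul_set, hR.smul_set]
  · rintro ⟨i⟩ ⟨j⟩ hij
    fin_cases i <;> fin_cases j
    exacts [absurd rfl hij, hd, hd.symm, absurd rfl hij]
  · rintro ⟨i⟩ ⟨j⟩ hij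
    fin_cases i <;> fin_cases j
    exacts [absurd rfl hij, hQR, hQR.symm, absurd rfl hij]
  · rintro ⟨i⟩ ⟨j⟩
    fin_cases i <;> fin_cases j
    exacts [hPQ.mono_left (hsub hPQ), hPR.mono_left (hsub hPQ), hPQ.mono_left (hsub hPR),
      hPR.mono_left (hsub hPR)]
  · have key {s : G} {T : Set α} (hs : ∀ x ∉ T, s • x ∈ T) : (p * s) • Tᶜ ⊆ p • T := by
      rintro _ ⟨x, hx, rfl⟩
      exact ⟨s • x, hs x hx, (mul_smul _ _ _).symm⟩
    rintro ⟨i⟩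
    fin_cases i
    exacts [key hqQ, key hrR]
  · have key {s : G} {T : Set α} (hs1 : s * s = 1) (hs : ∀ x ∉ T, s • x ∈ T) :
        (p * s)⁻¹ • (p • T)ᶜ ⊆ T := by
      rintro _ ⟨x, hx, rfl⟩
      change (p * s)⁻¹ • x ∈ T
      rw [mul_inv_rev, inv_eq_of_mul_eq_one_left hp, inv_eq_of_mul_eq_one_left hs1, mul_smul]
      exact hs _ fun h ↦ hx ⟨p • x, h, hp' x⟩
    rintro ⟨i⟩
    fin_cases i
    exacts [key hq hqQ, key hr hrR]

namespace CoxeterSystem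

variable {B W : Type*} [Group W] {M : CoxeterMatrix B} (cs : CoxeterSystem M W)

open scoped Pointwise in
/-- A Coxeter group with unrelated generators `a`, `b` and a third generator not commuting with `a`
contains a nonabelian free group. -/
theorem exists_injective_of_unrelated {B W : Type*} [Group W] {M : CoxeterMatrix B}
    (cs : CoxeterSystem M W) {a b c : B} (hab : a ≠ b) (hinf : M a b = 0)
    (hca : c ≠ a) (hcb : c ≠ b) (h2 : M a c ≠ 2) :
    ∃ f : FreeGroup (Fin 2) →* W, Function.Injective f := by
  obtain ⟨α, _, P, Q, hPQ, ⟨x₀, -, hx₀⟩, hP, hQ⟩ := cs.exists_action_of_eq_zero hab hinf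
  have hbQ : ∀ x ∉ Q, cs.simple b • x ∈ Q :=
    hQ _ (cs.simple_mem_deleted hab.symm) (cs.simple_notMem_deleted b)
  have hne : Q.Nonempty := ⟨_, hbQ x₀ hx₀⟩
  have hinvol (g : W) : (g * cs.simple b * g⁻¹) * (g * cs.simple b * g⁻¹) = 1 := by
    simp [mul_assoc]
  have hconj (g : W) : ∀ x ∉ g • Q, (g * cs.simple b * g⁻¹) • x ∈ g • Q := by
    intro x hx
    rw [Set.mem_smul_set_iff_inv_smul_mem] at hx ⊢
    simpa [mul_smul] using hbQ _ hx
  have ha := cs.simple_mem_deleted hab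
  have hc := cs.simple_mem_deleted hcb
  have hdisj {g : W} (hg : g ∈ cs.deleted b) (hg' : g ∉ cs.deleted a) : Disjoint Q (g • Q) := by
    rw [Set.disjoint_left]
    rintro _ hx ⟨y, hy, rfl⟩
    exact hPQ.notMem_of_mem_right hx (hP g hg hg' y (hPQ.notMem_of_mem_right hy))
  have haca : Disjoint (cs.simple a • Q) ((cs.simple c * cs.simple a) • Q) := by
    have := hdisj (mul_mem (mul_mem ha hc) ha) (cs.simple_conj_notMem_deleted hca h2)
    rw [← Set.disjoint_smul_set (a := cs.simple a)] at this
    simpa [smul_smul, mul_assoc] using this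
  refine ⟨_, FreeGroup.injective_lift_of_involutions (cs.simple_mul_simple_self b)
    (hinvol (cs.simple a)) (hinvol (cs.simple c * cs.simple a))
    (hdisj ha (cs.simple_notMem_deleted a)) (hdisj (mul_mem hc ha) fun h ↦ ?_) haca
    hne.smul_set hne.smul_set hbQ (hconj _) (hconj _)⟩
  exact cs.simple_notMem_deleted a
    ((Subgroup.mul_mem_cancel_left _ (cs.simple_mem_deleted hca)).mp h)

theorem commute_simple_of_eq_two {i j : B} (h : M i j = 2) :
    Commute (cs.simple i) (cs.simple j) := by
  have := cs.simple_mul_simple_pow i j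
  rw [h, pow_two] at this
  have := eq_inv_of_mul_eq_one_left this
  simpa [Commute, SemiconjBy] using this

end CoxeterSystem

/-- If `(W,S)` is a Coxeter system with `S` finite, `W` contains no free
subgroup of rank 2, and `a, b ∈ S` are unrelated (`m(a,b) = ∞`, encoded by the
Coxeter matrix entry being `0`), then `a` and `b` commute with every element of
`S − {a,b}`, and `W` is the internal direct product `⟨a,b⟩ × ⟨S − {a,b}⟩`. -/
theorem unrelated_pair_splits_off {B : Type*} [Finite B] {W : Type*} [Group W]
    (M : CoxeterMatrix B) (cs : CoxeterSystem M W)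
    (hfree : ¬ ∃ f : FreeGroup (Fin 2) →* W, Function.Injective f)
    (a b : B) (hab : a ≠ b) (hinf : M a b = 0) :
    (∀ c ∈ Set.univ \ ({a, b} : Set B),
        Commute (cs.simple a) (cs.simple c) ∧ Commute (cs.simple b) (cs.simple c)) ∧
    (∀ h ∈ Subgroup.closure ({cs.simple a, cs.simple b} : Set W),
      ∀ k ∈ Subgroup.closure (cs.simple '' (Set.univ \ {a, b})), Commute h k) ∧
    Subgroup.closure ({cs.simple a, cs.simple b} : Set W) ⊔
        Subgroup.closure (cs.simple '' (Set.univ \ {a, b})) = ⊤ ∧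
    Subgroup.closure ({cs.simple a, cs.simple b} : Set W) ⊓
        Subgroup.closure (cs.simple '' (Set.univ \ {a, b})) = ⊥ := by
  classical
  have two (c : B) (hc : c ∉ ({a, b} : Set B)) : M a c = 2 ∧ M b c = 2 := by
    simp only [Set.mem_insert_iff, Set.mem_singleton_iff, not_or] at hc
    constructor <;> by_contra h
    · exact hfree (cs.exists_injective_of_unrelated hab hinf hc.1 hc.2 h)
    · exact hfree (cs.exists_injective_of_unrelated hab.symm (M.symmetric b a ▸ hinf) hc.2 hc.1 h)
  have comm (c : B) (hc : c ∉ ({a, b} : Set B)) :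
      Commute (cs.simple a) (cs.simple c) ∧ Commute (cs.simple b) (cs.simple c) :=
    ⟨cs.commute_simple_of_eq_two (two c hc).1, cs.commute_simple_of_eq_two (two c hc).2⟩
  refine ⟨fun c hc ↦ comm c hc.2, fun h hh k hk ↦ ?_, ?_, ?_⟩
  · have hle : Subgroup.closure (cs.simple '' (Set.univ \ {a, b})) ≤
        Subgroup.centralizer (Subgroup.closure {cs.simple a, cs.simple b}) := by
      rw [Subgroup.centralizer_closure, Subgroup.closure_le]
      rintro _ ⟨c, hc, rfl⟩
      rw [SetLike.mem_coe, Subgroup.mem_centralizer_iff]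
      rintro _ (rfl | rfl)
      exacts [(comm c hc.2).1, (comm c hc.2).2]
    exact Subgroup.mem_centralizer_iff.mp (hle hk) h hh
  · rw [← Subgroup.closure_union, eq_top_iff, ← cs.subgroup_closure_range_simple]
    apply Subgroup.closure_mono
    rintro _ ⟨c, rfl⟩
    by_cases hc : c ∈ ({a, b} : Set B)
    · rcases hc with rfl | rfl <;> simp
    · exact Or.inr ⟨c, ⟨trivial, hc⟩, rfl⟩
  · let f : B → W := fun i ↦ if i ∈ ({a, b} : Set B) then cs.simple i else 1
    have hf : M.IsLiftable f := by
      intro i j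
      by_cases hi : i ∈ ({a, b} : Set B) <;> by_cases hj : j ∈ ({a, b} : Set B)
      · simp only [f, if_pos hi, if_pos hj, cs.simple_mul_simple_pow]
      · have : M i j = 2 := by
          rcases hi with rfl | rfl
          exacts [(two j hj).1, (two j hj).2]
        simp only [f, if_pos hi, if_neg hj, this, mul_one, cs.simple_sq]
      · have : M i j = 2 := by
          rw [M.symmetric]
          rcases hj with rfl | rfl
          exacts [(two i hi).1, (two i hi).2]
        simp only [f, if_neg hi, if_pos hj, this, one_mul, cs.simple_sq]
      · simp only [f, if_neg hi, if_neg hj, mul_one, one_pow]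
    have hid : Set.EqOn (cs.lift ⟨f, hf⟩) (MonoidHom.id W)
        (Subgroup.closure {cs.simple a, cs.simple b}) := by
      apply MonoidHom.eqOn_closure
      rintro _ (rfl | rfl) <;> rw [cs.lift_apply_simple hf] <;> simp [f]
    have hone : Set.EqOn (cs.lift ⟨f, hf⟩) (1 : W →* W)
        (Subgroup.closure (cs.simple '' (Set.univ \ {a, b}))) := by
      apply MonoidHom.eqOn_closure
      rintro _ ⟨c, hc, rfl⟩
      rw [cs.lift_apply_simple hf]
      exact if_neg hc.2
    rw [eq_bot_iff]
    exact fun h hh ↦ (hid hh.1).symm.trans (hone hh.2)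
end

section
/- Let (W,S) be a finitely generated Coxeter system in which W contains no nonabelian free subgroup. Then S is a disjoint union of subsets S₁, …, S_k that pairwise commute (every element of S_i commutes with every element of S_j for i ≠ j), and each ⟨S_i⟩ is either a finite Coxeter group or a Euclidean simplex reflection group. In particular W is virtually abelian. -/
/-- A group is a *Euclidean simplex reflection group* (irreducible affine
Coxeter group) iff it admits a Coxeter system on a finite generating set which
is irreducible (the Coxeter graph, with edges where `m(s,t) ≠ 2`, is
connected), is infinite, and is virtually free abelian. -/
def IsEuclideanSimplexGroup (G : Type*) [Group G] : Prop :=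
  Infinite G ∧
    (∃ (B : Type) (_ : Finite B) (M : CoxeterMatrix B),
      Nonempty (CoxeterSystem M G) ∧
        (SimpleGraph.fromRel (fun s t => M s t ≠ 2)).Connected) ∧
    ∃ (H : Subgroup G) (n : ℕ), H.FiniteIndex ∧
      Nonempty (H ≃* Multiplicative (Fin n → ℤ))

namespace CoxeterGeom

open Filter Topology

section Gram

variable {B : Type*} (M : CoxeterMatrix B)

/-- The Gram matrix of the standard bilinear form; the entry is `-1` when `M s t = 0`,
that is, when the product of the two generators has infinite order. -/
noncomputable def gram : Matrix B B ℝ := fun s t => -Real.cos (Real.pi / M s t)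

lemma gram_self (s : B) : gram M s s = 1 := by simp [gram]

lemma gram_symm (s t : B) : gram M s t = gram M t s := by
  simp only [gram, M.symmetric s t]

lemma gram_nonpos {s t : B} (h : s ≠ t) : gram M s t ≤ 0 := by
  have h1 := M.off_diagonal s t h
  rcases Nat.eq_zero_or_pos (M s t) with h0 | h0
  · simp [gram, h0]
  · have h2 : (2 : ℝ) ≤ M s t := by exact_mod_cast (by change M s t ≠ 1 at h1; omega : 2 ≤ M s t)
    have : 0 ≤ Real.cos (Real.pi / M s t) := by
      apply Real.cos_nonneg_of_mem_Icc
      have := Real.pi_pos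
      constructor
      · have : 0 ≤ Real.pi / M s t := by positivity
        linarith
      · exact div_le_div_of_nonneg_left this.le (by norm_num) h2
    simp only [gram]; linarith

lemma neg_one_le_gram (s t : B) : -1 ≤ gram M s t := by
  have := Real.cos_le_one (Real.pi / M s t)
  simp only [gram]; linarith

lemma sin_pi_div_pos {m : ℕ} (hm : 2 ≤ m) : 0 < Real.sin (Real.pi / m) := by
  have h2 : (2 : ℝ) ≤ m := by exact_mod_cast hm
  apply Real.sin_pos_of_pos_of_lt_pi
  · have := Real.pi_pos; positivity
  · rw [div_lt_iff₀ (by linarith)]; nlinarith [Real.pi_pos]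

end Gram

section Form

variable {B : Type*} [Fintype B] [DecidableEq B] (M : CoxeterMatrix B)

/-- The standard bilinear form of a Coxeter matrix. -/
noncomputable def form : LinearMap.BilinForm ℝ (B → ℝ) := Matrix.toBilin' (gram M)

/-- The simple root attached to a generator. -/
def simpleRoot (s : B) : B → ℝ := Pi.single s 1

/-- The orthogonal reflection in a vector `v` with `form M v v = 1`. -/
noncomputable def refl (v : B → ℝ) : Module.End ℝ (B → ℝ) :=
  LinearMap.id - ((2 : ℝ) • form M v).smulRight v

lemma refl_apply (v x : B → ℝ) : refl M v x = x - (2 * form M v x) • v := by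
  simp [refl]

lemma form_simpleRoot (s t : B) : form M (simpleRoot s) (simpleRoot t) = gram M s t :=
  Matrix.toBilin'_single _ _ _

lemma form_symm (x y : B → ℝ) : form M x y = form M y x := by
  simp only [form, Matrix.toBilin'_apply]
  rw [Finset.sum_comm]
  refine Finset.sum_congr rfl fun i _ => Finset.sum_congr rfl fun j _ => ?_
  rw [gram_symm M j i]; ring

lemma eq_sum_simpleRoot (x : B → ℝ) : x = ∑ s, x s • simpleRoot s := by
  simpa [simpleRoot] using pi_eq_sum_univ' x

lemma form_eq_sum (x y : B → ℝ) : form M x y = ∑ s, y s * form M x (simpleRoot s) := by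
  conv_lhs => rw [eq_sum_simpleRoot y]
  simp [map_sum]

lemma refl_simpleRoot_self (s : B) : refl M (simpleRoot s) (simpleRoot s) = -simpleRoot s := by
  rw [refl_apply, form_simpleRoot, gram_self]
  module

lemma form_refl_refl {v : B → ℝ} (hv : form M v v = 1) (x y : B → ℝ) :
    form M (refl M v x) (refl M v y) = form M x y := by
  simp only [refl_apply, map_sub, LinearMap.sub_apply, map_smul, LinearMap.smul_apply,
    smul_eq_mul, hv, form_symm M x v]
  ring

lemma refl_refl {v : B → ℝ} (hv : form M v v = 1) (x : B → ℝ) :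
    refl M v (refl M v x) = x := by
  simp only [refl_apply, map_sub, map_smul, hv]
  module

lemma refl_mul_refl_pow_left (s t : B) (k : ℕ) :
    Real.sin (Real.pi / M s t) • ((refl M (simpleRoot s) * refl M (simpleRoot t)) ^ k)
      (simpleRoot s) =
    Real.sin ((2 * k + 1) * (Real.pi / M s t)) • simpleRoot s
      + Real.sin (2 * k * (Real.pi / M s t)) • simpleRoot t := by
  induction k with
  | zero => simp
  | succ k ih =>
    set θ := Real.pi / M s t with hθ
    have hst : form M (simpleRoot s) (simpleRoot t) = - Real.cos θ := form_simpleRoot M s t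
    have hts : form M (simpleRoot t) (simpleRoot s) = - Real.cos θ := by
      rw [form_symm, hst]
    have hss : form M (simpleRoot s) (simpleRoot s) = 1 := by rw [form_simpleRoot, gram_self]
    have htt : form M (simpleRoot t) (simpleRoot t) = 1 := by rw [form_simpleRoot, gram_self]
    rw [pow_succ', Module.End.mul_apply, ← map_smul, ih]
    simp only [Module.End.mul_apply, map_add, map_smul, refl_apply, map_sub, hst, hts, hss, htt]
    have e1 : Real.sin ((2 * (k + 1 : ℕ)) * θ) =
        2 * Real.cos θ * Real.sin ((2 * k + 1) * θ) - Real.sin (2 * k * θ) := by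
      push_cast
      rw [show (2 * ((k : ℝ) + 1)) * θ = (2 * k + 1) * θ + θ by ring,
        show 2 * (k : ℝ) * θ = (2 * k + 1) * θ - θ by ring, Real.sin_add, Real.sin_sub]
      ring
    have e2 : Real.sin ((2 * (k + 1 : ℕ) + 1) * θ) =
        2 * Real.cos θ * Real.sin ((2 * (k + 1 : ℕ)) * θ) - Real.sin ((2 * k + 1) * θ) := by
      push_cast
      rw [show (2 * ((k : ℝ) + 1) + 1) * θ = (2 * (k + 1)) * θ + θ by ring,
        show (2 * (k : ℝ) + 1) * θ = (2 * (k + 1)) * θ - θ by ring, Real.sin_add, Real.sin_sub]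
      ring
    rw [e2, e1]
    module

lemma refl_mul_refl_pow_simpleRoot (s t : B) (hm : 2 ≤ M s t) :
    ((refl M (simpleRoot s) * refl M (simpleRoot t)) ^ (M s t)) (simpleRoot s) = simpleRoot s := by
  have h := refl_mul_refl_pow_left M s t (M s t)
  have hs := sin_pi_div_pos hm
  have hm0 : (M s t : ℝ) ≠ 0 := by positivity
  have e1 : (2 * (M s t : ℝ) + 1) * (Real.pi / M s t) = Real.pi / M s t + 2 * Real.pi := by
    field_simp; ring
  have e2 : 2 * (M s t : ℝ) * (Real.pi / M s t) = 2 * Real.pi := by field_simp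
  rw [e1, e2, Real.sin_add_two_pi, Real.sin_two_pi, zero_smul, add_zero] at h
  exact smul_right_injective _ hs.ne' h

lemma isLiftable_refl : M.IsLiftable fun s => refl M (simpleRoot s) := by
  intro s t
  have hss : ∀ s : B, form M (simpleRoot s) (simpleRoot s) = 1 := fun s => by
    rw [form_simpleRoot, gram_self]
  rcases eq_or_ne s t with rfl | hst
  · rw [M.diagonal, pow_one]
    exact LinearMap.ext fun x => refl_refl M (hss s) x
  rcases Nat.eq_zero_or_pos (M s t) with h0 | h0
  · rw [h0, pow_zero]
  have hm : 2 ≤ M s t := by have : M s t ≠ 1 := M.off_diagonal s t hst; omega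
  set R := refl M (simpleRoot s) * refl M (simpleRoot t) with hR
  have h1 : (R ^ M s t) (simpleRoot s) = simpleRoot s := refl_mul_refl_pow_simpleRoot M s t hm
  have h2 : (R ^ M s t) (simpleRoot t) = simpleRoot t := by
    have h3 := refl_mul_refl_pow_simpleRoot M t s (by rwa [M.symmetric])
    rw [M.symmetric t s] at h3
    have h4 : (refl M (simpleRoot t) * refl M (simpleRoot s)) * R = 1 := by
      refine LinearMap.ext fun x => ?_
      simp only [hR, Module.End.mul_apply, Module.End.one_apply, refl_refl M (hss _)]
    have h6 : R * (refl M (simpleRoot t) * refl M (simpleRoot s)) = 1 := by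
      refine LinearMap.ext fun x => ?_
      simp only [hR, Module.End.mul_apply, Module.End.one_apply, refl_refl M (hss _)]
    have h5 : R ^ M s t * (refl M (simpleRoot t) * refl M (simpleRoot s)) ^ M s t = 1 := by
      rw [← Commute.mul_pow (h6.trans h4.symm), h6, one_pow]
    conv_lhs => rw [← h3]
    rw [← Module.End.mul_apply, h5, Module.End.one_apply]
  have hs := sin_pi_div_pos hm
  set c := gram M s t with hc
  have hc2 : 1 - c ^ 2 ≠ 0 := by
    have := Real.sin_sq_add_cos_sq (Real.pi / M s t)
    have h3 : c ^ 2 = Real.cos (Real.pi / M s t) ^ 2 := by simp [hc, gram]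
    have : 0 < Real.sin (Real.pi / M s t) ^ 2 := by positivity
    intro h; linarith
  refine LinearMap.ext fun x => ?_
  rw [Module.End.one_apply]
  set p := form M (simpleRoot s) x with hp
  set q := form M (simpleRoot t) x with hq
  have fst : form M (simpleRoot s) (simpleRoot t) = c := form_simpleRoot M s t
  have fts : form M (simpleRoot t) (simpleRoot s) = c := by rw [form_symm, fst]
  set a := (p - c * q) / (1 - c ^ 2) with ha
  set b := (q - c * p) / (1 - c ^ 2) with hb
  set x0 := x - (a • simpleRoot s + b • simpleRoot t) with hx0
  have hx : x = x0 + (a • simpleRoot s + b • simpleRoot t) := by rw [hx0]; abel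
  have o1 : form M (simpleRoot s) x0 = 0 := by
    simp only [hx0, map_sub, map_add, map_smul, smul_eq_mul, hss, fst, ← hp, ha, hb]
    field_simp; ring
  have o2 : form M (simpleRoot t) x0 = 0 := by
    simp only [hx0, map_sub, map_add, map_smul, smul_eq_mul, hss, fts, ← hq, ha, hb]
    field_simp; ring
  have o3 : R x0 = x0 := by
    simp [hR, Module.End.mul_apply, refl_apply, o1, o2]
  have o4 : (R ^ M s t) x0 = x0 := by
    rw [Module.End.pow_apply]
    exact Function.iterate_fixed o3 _
  rw [hx, map_add, map_add, map_smul, map_smul, o4, h1, h2]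

end Form

section Rep

variable {B : Type*} [Fintype B] [DecidableEq B] {M : CoxeterMatrix B}
  {W : Type*} [Group W] (cs : CoxeterSystem M W)

/-- The geometric representation of a Coxeter group. -/
noncomputable def rep : W →* Module.End ℝ (B → ℝ) := cs.lift ⟨_, isLiftable_refl M⟩

lemma rep_simple (s : B) : rep cs (cs.simple s) = refl M (simpleRoot s) :=
  cs.lift_apply_simple _ _

lemma form_simpleRoot_self (s : B) : form M (simpleRoot s) (simpleRoot s) = 1 := by
  rw [form_simpleRoot, gram_self]

lemma rep_mul_apply (v w : W) (x : B → ℝ) : rep cs (v * w) x = rep cs v (rep cs w x) := by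
  rw [map_mul, Module.End.mul_apply]

lemma rep_one_apply (x : B → ℝ) : rep cs 1 x = x := by
  rw [map_one, Module.End.one_apply]

lemma rep_inv_apply_apply (w : W) (x : B → ℝ) : rep cs w⁻¹ (rep cs w x) = x := by
  rw [← rep_mul_apply, inv_mul_cancel, rep_one_apply]

lemma rep_apply_inv_apply (w : W) (x : B → ℝ) : rep cs w (rep cs w⁻¹ x) = x := by
  rw [← rep_mul_apply, mul_inv_cancel, rep_one_apply]

lemma form_rep_rep (w : W) : ∀ x y, form M (rep cs w x) (rep cs w y) = form M x y := by
  induction w using cs.simple_induction with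
  | simple s =>
    intro x y
    rw [rep_simple, form_refl_refl M (form_simpleRoot_self s)]
  | one => intro x y; simp only [rep_one_apply]
  | mul v w hv hw => intro x y; rw [rep_mul_apply, rep_mul_apply, hv, hw]

lemma form_rep_left (w : W) (x y : B → ℝ) : form M (rep cs w x) y = form M x (rep cs w⁻¹ y) := by
  rw [← form_rep_rep cs w x, rep_apply_inv_apply]

/-- A root is an image of a simple root under the Coxeter group. -/
def IsRoot (γ : B → ℝ) : Prop := ∃ (w : W) (s : B), γ = rep cs w (simpleRoot s)

variable {cs}

lemma isRoot_simpleRoot (s : B) : IsRoot cs (simpleRoot s) := ⟨1, s, (rep_one_apply cs _).symm⟩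

lemma IsRoot.rep {γ : B → ℝ} (h : IsRoot cs γ) (w : W) : IsRoot cs (rep cs w γ) := by
  obtain ⟨v, s, rfl⟩ := h
  exact ⟨w * v, s, (rep_mul_apply cs _ _ _).symm⟩

lemma IsRoot.form_self {γ : B → ℝ} (h : IsRoot cs γ) : form M γ γ = 1 := by
  obtain ⟨v, s, rfl⟩ := h
  rw [form_rep_rep, form_simpleRoot_self]

lemma IsRoot.ne_zero {γ : B → ℝ} (h : IsRoot cs γ) : γ ≠ 0 := by
  rintro rfl
  simpa using h.form_self

lemma IsRoot.exists_reflection {γ : B → ℝ} (h : IsRoot cs γ) :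
    ∃ r : W, r * r = 1 ∧ ∀ x, CoxeterGeom.rep cs r x = x - (2 * form M γ x) • γ := by
  obtain ⟨v, s, rfl⟩ := h
  refine ⟨v * cs.simple s * v⁻¹, by group; simp [mul_assoc], fun x => ?_⟩
  rw [rep_mul_apply, rep_mul_apply, rep_simple, refl_apply, map_sub, map_smul,
    rep_apply_inv_apply, form_rep_left]

lemma IsRoot.neg {γ : B → ℝ} (h : IsRoot cs γ) : IsRoot cs (-γ) := by
  obtain ⟨r, -, hr⟩ := h.exists_reflection
  have := h.rep r
  rw [hr, h.form_self] at this
  convert this using 1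
  module

end Rep

section Positivity

/-- A vector all of whose coordinates are either zero or at least one. -/
def IsAdmissible {B : Type*} (v : B → ℝ) : Prop := ∀ s, v s = 0 ∨ 1 ≤ v s

lemma IsAdmissible.nonneg {B : Type*} {v : B → ℝ} (h : IsAdmissible v) : 0 ≤ v := by
  intro s
  rcases h s with h | h
  · exact h.ge
  · exact zero_le_one.trans h

lemma IsAdmissible.smul_add_smul {B : Type*} {v w : B → ℝ} (hv : IsAdmissible v)
    (hw : IsAdmissible w) {a b : ℝ} (ha : a = 0 ∨ 1 ≤ a) (hb : b = 0 ∨ 1 ≤ b) :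
    IsAdmissible (a • v + b • w) := by
  have hmul : ∀ {x y : ℝ}, (x = 0 ∨ 1 ≤ x) → (y = 0 ∨ 1 ≤ y) → (x * y = 0 ∨ 1 ≤ x * y) := by
    rintro x y (rfl | hx) (rfl | hy)
    · simp
    · simp
    · simp
    · exact Or.inr (one_le_mul_of_one_le_of_one_le hx hy)
  intro s
  simp only [Pi.add_apply, Pi.smul_apply, smul_eq_mul]
  rcases hmul ha (hv s) with h1 | h1 <;> rcases hmul hb (hw s) with h2 | h2
  · left; rw [h1, h2, add_zero]
  · right; linarith
  · right; linarith
  · right; linarith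

/-- The coefficients of the roots of a dihedral group, a rescaled Chebyshev sequence. -/
noncomputable def dihedralCoeff (c : ℝ) : ℕ → ℝ
  | 0 => 0
  | 1 => 1
  | k + 2 => 2 * c * dihedralCoeff c (k + 1) - dihedralCoeff c k

lemma dihedralCoeff_one (k : ℕ) : dihedralCoeff 1 k = k := by
  induction k using Nat.twoStepInduction with
  | zero => simp [dihedralCoeff]
  | one => simp [dihedralCoeff]
  | more k h1 h2 => rw [dihedralCoeff, h1, h2]; push_cast; ring

lemma sin_mul_dihedralCoeff_cos (θ : ℝ) (k : ℕ) :
    Real.sin θ * dihedralCoeff (Real.cos θ) k = Real.sin (k * θ) := by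
  induction k using Nat.twoStepInduction with
  | zero => simp [dihedralCoeff]
  | one => simp [dihedralCoeff]
  | more k h1 h2 =>
    rw [dihedralCoeff, mul_sub, h1,
      show Real.sin θ * (2 * Real.cos θ * dihedralCoeff (Real.cos θ) (k + 1)) =
        2 * Real.cos θ * (Real.sin θ * dihedralCoeff (Real.cos θ) (k + 1)) by ring, h2]
    push_cast
    rw [show ((k : ℝ) + 2) * θ = (k + 1) * θ + θ by ring,
      show (k : ℝ) * θ = (k + 1) * θ - θ by ring, Real.sin_add, Real.sin_sub]
    ring

lemma dihedralCoeff_eq_zero_or_one_le {B : Type*} (M : CoxeterMatrix B) {s t : B} (hst : s ≠ t)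
    {k : ℕ} (hk : M s t = 0 ∨ k ≤ M s t) :
    dihedralCoeff (-gram M s t) k = 0 ∨ 1 ≤ dihedralCoeff (-gram M s t) k := by
  rcases Nat.eq_zero_or_pos (M s t) with h0 | h0
  · have : -gram M s t = 1 := by simp [gram, h0]
    rw [this, dihedralCoeff_one]
    rcases Nat.eq_zero_or_pos k with rfl | h
    · simp
    · right; exact_mod_cast h
  have hm : 2 ≤ M s t := by have : M s t ≠ 1 := M.off_diagonal s t hst; omega
  replace hk : k ≤ M s t := by omega
  set θ := Real.pi / M s t with hθ
  have hs : 0 < Real.sin θ := sin_pi_div_pos hm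
  have hc : -gram M s t = Real.cos θ := by simp [gram, hθ]
  have key := sin_mul_dihedralCoeff_cos θ k
  rw [hc]
  have hm0 : (0 : ℝ) < M s t := by exact_mod_cast h0
  have hmθ : M s t * θ = Real.pi := by rw [hθ]; field_simp
  have hθ0 : 0 < θ := by rw [hθ]; have := Real.pi_pos; positivity
  rcases Nat.eq_zero_or_pos k with rfl | hk0
  · simp [dihedralCoeff]
  rcases hk.eq_or_lt with rfl | hlt
  · left
    rw [hmθ, Real.sin_pi] at key
    exact (mul_eq_zero.1 key).resolve_left hs.ne'
  right
  have h1 : (1 : ℝ) ≤ k := by exact_mod_cast hk0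
  have h2 : (k : ℝ) + 1 ≤ M s t := by exact_mod_cast hlt
  have hle : Real.sin θ ≤ Real.sin (k * θ) := by
    have e1 : θ ≤ k * θ := by nlinarith
    have e2 : k * θ ≤ Real.pi - θ := by rw [← hmθ]; nlinarith
    rcases le_total (k * θ) (Real.pi / 2) with h | h
    · exact Real.sin_le_sin_of_le_of_le_pi_div_two (by linarith [Real.pi_pos]) h e1
    · rw [← Real.sin_pi_sub (k * θ)]
      exact Real.sin_le_sin_of_le_of_le_pi_div_two (by linarith [Real.pi_pos])
        (by linarith) (by linarith)
  rw [← key] at hle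
  by_contra! h
  nlinarith

lemma isAdmissible_simpleRoot {B : Type*} [DecidableEq B] (s : B) :
    IsAdmissible (simpleRoot s) := by
  intro t
  rcases eq_or_ne t s with rfl | h
  · right; simp [simpleRoot]
  · left; simp [simpleRoot, h]

lemma exists_eq_mul_alternatingWord {B : Type*} {M : CoxeterMatrix B} {W : Type*} [Group W]
    (cs : CoxeterSystem M W) (n : ℕ) : ∀ (w : W) (s t : B), cs.length w = n →
    ¬ cs.IsRightDescent w s → ∃ (v : W) (k : ℕ),
      w = v * cs.wordProd (CoxeterSystem.alternatingWord s t k) ∧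
      cs.length w = cs.length v + k ∧ ¬ cs.IsRightDescent v s ∧ ¬ cs.IsRightDescent v t := by
  induction n with
  | zero =>
    intro w s t hw hs
    rw [cs.length_eq_zero_iff] at hw
    subst hw
    exact ⟨1, 0, by simp [CoxeterSystem.alternatingWord], by simp,
      cs.not_isRightDescent_one s, cs.not_isRightDescent_one t⟩
  | succ n ih =>
    intro w s t hw hs
    by_cases ht : cs.IsRightDescent w t
    · obtain ⟨v, k, h1, h2, h3, h4⟩ := ih (w * cs.simple t) t s
        (by have := cs.isRightDescent_iff.1 ht; omega)
        (cs.isRightDescent_iff_not_isRightDescent_mul.1 ht)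
      refine ⟨v, k + 1, ?_, ?_, h4, h3⟩
      · rw [CoxeterSystem.alternatingWord_succ, cs.wordProd_concat, ← mul_assoc, ← h1,
          cs.simple_mul_simple_cancel_right]
      · have := cs.isRightDescent_iff.1 ht; omega
    · exact ⟨w, 0, by simp [CoxeterSystem.alternatingWord], by simp, hs, ht⟩

variable {B : Type*} [Fintype B] [DecidableEq B] {M : CoxeterMatrix B}
  {W : Type*} [Group W] (cs : CoxeterSystem M W)

lemma rep_alternatingWord_simpleRoot (s t : B) (k : ℕ) :
    rep cs (cs.wordProd (CoxeterSystem.alternatingWord s t k)) (simpleRoot s) =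
      if Even k then dihedralCoeff (-gram M s t) (k + 1) • simpleRoot s +
        dihedralCoeff (-gram M s t) k • simpleRoot t
      else dihedralCoeff (-gram M s t) k • simpleRoot s +
        dihedralCoeff (-gram M s t) (k + 1) • simpleRoot t := by
  induction k with
  | zero => simp [CoxeterSystem.alternatingWord, dihedralCoeff]
  | succ k ih =>
    rw [CoxeterSystem.alternatingWord_succ', cs.wordProd_cons, rep_mul_apply, ih, rep_simple]
    have hts : gram M t s = gram M s t := gram_symm M t s
    by_cases hk : Even k
    · have hk' : ¬ Even (k + 1) := by simpa [Nat.even_add_one] using hk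
      simp only [hk, hk', if_true, if_false, refl_apply, map_add, map_smul, form_simpleRoot,
        gram_self, hts, dihedralCoeff]
      module
    · have hk' : Even (k + 1) := by simpa [Nat.even_add_one] using hk
      simp only [hk, hk', if_true, if_false, refl_apply, map_add, map_smul, form_simpleRoot,
        gram_self, dihedralCoeff]
      module

lemma isAdmissible_rep_simpleRoot {w : W} {s : B} (hs : ¬ cs.IsRightDescent w s) :
    IsAdmissible (rep cs w (simpleRoot s)) := by
  induction hn : cs.length w using Nat.strong_induction_on generalizing w s with
  | _ n ih =>
    rcases eq_or_ne w 1 with rfl | hw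
    · rw [rep_one_apply]; exact isAdmissible_simpleRoot s
    obtain ⟨t, ht⟩ := cs.exists_rightDescent_of_ne_one hw
    have hst : s ≠ t := by rintro rfl; exact hs ht
    obtain ⟨v, k, h1, h2, h3, h4⟩ := exists_eq_mul_alternatingWord cs _ w s t rfl hs
    have hk : k ≠ 0 := by
      rintro rfl
      simp only [CoxeterSystem.alternatingWord, CoxeterSystem.wordProd_nil, mul_one] at h1
      exact h4 (h1 ▸ ht)
    have hvs := ih (cs.length v) (by omega) h3 rfl
    have hvt := ih (cs.length v) (by omega) h4 rfl
    have hkm : M s t = 0 ∨ k + 1 ≤ M s t := by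
      by_contra! hcon
      refine cs.not_isReduced_alternatingWord t s (m := k + 1) (by rw [M.symmetric]; exact hcon.1)
        (by rw [M.symmetric]; exact hcon.2) ?_
      have e1 := cs.not_isRightDescent_iff.1 hs
      have e2 : w * cs.simple s =
          v * cs.wordProd (CoxeterSystem.alternatingWord t s (k + 1)) := by
        rw [CoxeterSystem.alternatingWord_succ, cs.wordProd_concat, ← mul_assoc, ← h1]
      have e3 := cs.length_mul_le v (cs.wordProd (CoxeterSystem.alternatingWord t s (k + 1)))
      have e4 := cs.length_wordProd_le (CoxeterSystem.alternatingWord t s (k + 1))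
      rw [← e2] at e3
      rw [CoxeterSystem.length_alternatingWord] at e4
      rw [CoxeterSystem.IsReduced, CoxeterSystem.length_alternatingWord]
      omega
    have c1 := dihedralCoeff_eq_zero_or_one_le M hst hkm
    have c2 := dihedralCoeff_eq_zero_or_one_le M hst (k := k) (hkm.imp_right (by omega))
    rw [h1, rep_mul_apply, rep_alternatingWord_simpleRoot]
    split_ifs <;> rw [map_add, map_smul, map_smul]
    · exact hvs.smul_add_smul hvt c1 c2
    · exact hvs.smul_add_smul hvt c2 c1

variable {cs}

lemma rep_simple_simpleRoot_self (s : B) :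
    rep cs (cs.simple s) (simpleRoot s) = -simpleRoot s := by
  rw [rep_simple, refl_simpleRoot_self]

lemma isAdmissible_neg_rep_simpleRoot {w : W} {s : B} (hs : cs.IsRightDescent w s) :
    IsAdmissible (-rep cs w (simpleRoot s)) := by
  have h := isAdmissible_rep_simpleRoot cs (cs.isRightDescent_iff_not_isRightDescent_mul.1 hs)
  rwa [rep_mul_apply, rep_simple_simpleRoot_self, map_neg] at h

lemma IsRoot.isAdmissible_or {γ : B → ℝ} (h : IsRoot cs γ) :
    IsAdmissible γ ∨ IsAdmissible (-γ) := by
  obtain ⟨w, s, rfl⟩ := h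
  by_cases hs : cs.IsRightDescent w s
  · exact Or.inr (isAdmissible_neg_rep_simpleRoot hs)
  · exact Or.inl (isAdmissible_rep_simpleRoot cs hs)

lemma IsRoot.nonneg_or {γ : B → ℝ} (h : IsRoot cs γ) : 0 ≤ γ ∨ γ ≤ 0 := by
  rcases h.isAdmissible_or with h | h
  · exact Or.inl h.nonneg
  · exact Or.inr (by simpa using h.nonneg)

lemma eq_one_of_rep_simpleRoot {w : W} (h : ∀ s, rep cs w (simpleRoot s) = simpleRoot s) :
    w = 1 := by
  by_contra hw
  obtain ⟨s, hs⟩ := cs.exists_rightDescent_of_ne_one hw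
  have h1 := (isAdmissible_neg_rep_simpleRoot hs).nonneg s
  rw [h s] at h1
  simp [simpleRoot] at h1
  linarith

lemma IsRoot.eq_simpleRoot {γ : B → ℝ} (h : IsRoot cs γ) (h0 : 0 ≤ γ) {s : B}
    (hs : ∀ t, t ≠ s → γ t = 0) : γ = simpleRoot s := by
  have h1 : γ = γ s • simpleRoot s := by
    ext t
    rcases eq_or_ne t s with rfl | ht
    · simp [simpleRoot]
    · simp [simpleRoot, ht, hs t ht]
  have h2 := h.form_self
  rw [h1] at h2
  simp only [map_smul, LinearMap.smul_apply, form_simpleRoot_self, smul_eq_mul, mul_one] at h2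
  have h3 : γ s = 1 := by nlinarith [h0 s, show (0 : B → ℝ) s = 0 from rfl]
  rw [h1, h3, one_smul]

lemma IsRoot.rep_simple_nonneg {γ : B → ℝ} (h : IsRoot cs γ) (h0 : 0 ≤ γ) {s : B}
    (hs : γ ≠ simpleRoot s) : 0 ≤ CoxeterGeom.rep cs (cs.simple s) γ := by
  obtain ⟨t, hts, ht⟩ : ∃ t, t ≠ s ∧ γ t ≠ 0 := by
    by_contra! hcon
    exact hs (h.eq_simpleRoot h0 hcon)
  rcases (h.rep (cs.simple s)).nonneg_or with h1 | h1
  · exact h1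
  · exfalso
    have h2 := h1 t
    rw [rep_simple, refl_apply] at h2
    simp [simpleRoot, hts] at h2
    exact ht (le_antisymm h2 (h0 t))

variable (cs) in
/-- The set of positive roots made negative by `w`. -/
def inversionSet (w : W) : Set (B → ℝ) := {γ | IsRoot cs γ ∧ 0 ≤ γ ∧ rep cs w γ ≤ 0}

lemma finite_inversionSet (w : W) : (inversionSet cs w).Finite := by
  induction w using cs.simple_induction_right with
  | one =>
    convert Set.finite_empty
    refine Set.eq_empty_of_forall_notMem fun γ ⟨h1, h2, h3⟩ => h1.ne_zero ?_
    rw [rep_one_apply] at h3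
    exact le_antisymm h3 h2
  | mul_simple_right w s ih =>
    refine ((ih.image (rep cs (cs.simple s))).union (Set.finite_singleton (simpleRoot s))).subset ?_
    rintro γ ⟨h1, h2, h3⟩
    by_cases hs : γ = simpleRoot s
    · exact Or.inr hs
    · refine Or.inl ⟨rep cs (cs.simple s) γ, ⟨h1.rep _, h1.rep_simple_nonneg h2 hs, ?_⟩, ?_⟩
      · rwa [← rep_mul_apply]
      · rw [← rep_mul_apply, cs.simple_mul_simple_self, rep_one_apply]

end Positivity

section Hyperbolic

variable {B : Type*} [Fintype B] [DecidableEq B] {M : CoxeterMatrix B}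
  {W : Type*} [Group W] {cs : CoxeterSystem M W}

/-- Two roots whose product is less than `-1` generate a sequence of roots which grows along an
isotropic direction `x`. -/
lemma exists_isRoot_seq {α β : B → ℝ} (hα : IsRoot cs α) (hβ : IsRoot cs β)
    (h : form M α β < -1) :
    ∃ (γ : ℕ → B → ℝ) (c d : ℕ → ℝ) (x y : B → ℝ),
      (∀ n, IsRoot cs (γ n)) ∧ Function.Injective γ ∧
      (∀ n, ∃ p q : ℝ, 0 ≤ p ∧ 0 ≤ q ∧ γ n = p • α + q • β) ∧
      Tendsto c atTop atTop ∧ Tendsto d atTop (𝓝 0) ∧ (∀ n, γ n = c n • x + d n • y) ∧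
      form M x x = 0 ∧ form M x y < 0 := by
  obtain ⟨r, -, hr⟩ := hα.exists_reflection
  obtain ⟨s, -, hs⟩ := hβ.exists_reflection
  set a := -form M α β with ha
  have hαβ : form M α β = -a := by rw [ha]; ring
  have hβα : form M β α = -a := by rw [form_symm, hαβ]
  have hαα := hα.form_self
  have hββ := hβ.form_self
  have ha1 : 1 < a := by linarith
  obtain ⟨μ, ν, hμ1, hν0, hμν, hadd⟩ : ∃ μ ν : ℝ, 1 < μ ∧ 0 < ν ∧ μ * ν = 1 ∧ μ + ν = 2 * a := by
    have hsq : Real.sqrt (a ^ 2 - 1) ^ 2 = a ^ 2 - 1 := Real.sq_sqrt (by nlinarith)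
    have hpos := Real.sqrt_nonneg (a ^ 2 - 1)
    refine ⟨a + Real.sqrt (a ^ 2 - 1), a - Real.sqrt (a ^ 2 - 1), by linarith, ?_, ?_, by ring⟩
    · have : Real.sqrt (a ^ 2 - 1) < a := by
        rw [Real.sqrt_lt' (by linarith)]; linarith
      linarith
    · linear_combination -hsq
  have hν1 : ν < 1 := by
    by_contra hcon
    nlinarith
  have ha' : a = (μ + ν) / 2 := by linarith
  have hx : rep cs (r * s) (α + ν • β) = μ ^ 2 • (α + ν • β) := by
    simp only [rep_mul_apply, hr, hs, map_add, map_sub, map_smul, smul_eq_mul, hαα, hββ, hαβ, hβα]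
    match_scalars
    · rw [ha']; linear_combination hμν
    · rw [ha']; linear_combination (-μ) * hμν
  have hy : rep cs (r * s) (α + μ • β) = ν ^ 2 • (α + μ • β) := by
    simp only [rep_mul_apply, hr, hs, map_add, map_sub, map_smul, smul_eq_mul, hαα, hββ, hαβ, hβα]
    match_scalars
    · rw [ha']; linear_combination hμν
    · rw [ha']; linear_combination (-ν) * hμν
  have hsub : 0 < μ - ν := by linarith
  have hα' : α = (μ / (μ - ν)) • (α + ν • β) + (-ν / (μ - ν)) • (α + μ • β) := by
    match_scalars
    · field_simp; ring
    · field_simp; ring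
  have hpow : ∀ n : ℕ, rep cs ((r * s) ^ n) α =
      (μ ^ (2 * n + 1) / (μ - ν)) • (α + ν • β) +
        (-ν ^ (2 * n + 1) / (μ - ν)) • (α + μ • β) := by
    intro n
    induction n with
    | zero => simpa [rep_one_apply] using hα'
    | succ n ih =>
      rw [pow_succ', rep_mul_apply, ih, map_add, map_smul, map_smul, hx, hy, smul_smul, smul_smul]
      congr 2 <;> ring
  have hxx : form M (α + ν • β) (α + ν • β) = 0 := by
    simp only [map_add, LinearMap.add_apply, map_smul, LinearMap.smul_apply, smul_eq_mul, hαα, hββ,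
      hαβ, hβα, ha']
    linear_combination (-1 : ℝ) * hμν
  have hxy : form M (α + ν • β) (α + μ • β) < 0 := by
    simp only [map_add, LinearMap.add_apply, map_smul, LinearMap.smul_apply, smul_eq_mul, hαα, hββ,
      hαβ, hβα, ha']
    nlinarith
  have hyy : form M (α + μ • β) (α + μ • β) = 0 := by
    simp only [map_add, LinearMap.add_apply, map_smul, LinearMap.smul_apply, smul_eq_mul, hαα, hββ,
      hαβ, hβα, ha']
    linear_combination (-1 : ℝ) * hμν
  have hmul : Tendsto (fun n : ℕ => 2 * n + 1) atTop atTop :=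
    tendsto_atTop_mono (fun n => (by omega : n ≤ 2 * n + 1)) tendsto_id
  have hc : Tendsto (fun n : ℕ => μ ^ (2 * n + 1) / (μ - ν)) atTop atTop :=
    ((tendsto_pow_atTop_atTop_of_one_lt hμ1).comp hmul).atTop_div_const hsub
  have hd : Tendsto (fun n : ℕ => -ν ^ (2 * n + 1) / (μ - ν)) atTop (𝓝 0) := by
    have := (((tendsto_pow_atTop_nhds_zero_of_lt_one hν0.le hν1).comp hmul).neg).div_const (μ - ν)
    simpa using this
  refine ⟨fun n => rep cs ((r * s) ^ n) α, _, _, _, _, fun n => hα.rep _, ?_, ?_, hc, hd, hpow,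
    hxx, hxy⟩
  · intro m n hmn
    have h1 := congrArg (form M (α + μ • β)) hmn
    simp only [hpow, map_add (form M (α + μ • β)) (_ • (α + ν • β)),
      map_smul (form M (α + μ • β)) _ (α + ν • β), map_smul (form M (α + μ • β)) _ (α + μ • β),
      smul_eq_mul, hyy, mul_zero, add_zero, form_symm M (α + μ • β) (α + ν • β)] at h1
    have h2 := mul_right_cancel₀ hxy.ne h1
    rw [div_left_inj' hsub.ne'] at h2
    have h3 := pow_right_injective₀ (by linarith) hμ1.ne' h2
    omega
  · intro n
    have hle : ∀ k : ℕ, 0 ≤ (μ ^ k - ν ^ k) / (μ - ν) := fun k =>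
      div_nonneg (sub_nonneg.2 (pow_le_pow_left₀ hν0.le (by linarith) k)) hsub.le
    refine ⟨_, _, hle (2 * n + 1), hle (2 * n), ?_⟩
    refine (hpow n).trans ?_
    match_scalars
    · ring
    · field_simp
      linear_combination (μ ^ (2 * n) - ν ^ (2 * n)) * hμν

end Hyperbolic

section PingPong

variable {B : Type*} [Fintype B] [DecidableEq B] {M : CoxeterMatrix B}
  {W : Type*} [Group W] {cs : CoxeterSystem M W}

open scoped Pointwise

variable (cs) in
/-- The elements of the group which lie on the negative side of the wall of `γ`. -/
def negHalf (γ : B → ℝ) : Set W := {w | rep cs w⁻¹ γ ≤ 0}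

lemma IsRoot.rep_inv_nonneg {γ : B → ℝ} (h : IsRoot cs γ) {w : W} (hw : w ∉ negHalf cs γ) :
    0 ≤ CoxeterGeom.rep cs w⁻¹ γ :=
  (h.rep w⁻¹).nonneg_or.resolve_right hw

lemma IsRoot.mul_mem_negHalf {γ : B → ℝ} (h : IsRoot cs γ) {r w : W} (hr : r⁻¹ = r)
    (hrγ : CoxeterGeom.rep cs r γ = -γ) (hw : w ∉ negHalf cs γ) : r * w ∈ negHalf cs γ := by
  have := h.rep_inv_nonneg hw
  simpa [negHalf, rep_mul_apply, hr, hrγ] using this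

lemma disjoint_negHalf {α β : B → ℝ} (hα : IsRoot cs α) (hβ : IsRoot cs β) (hα0 : 0 ≤ α)
    (hβ0 : 0 ≤ β) (h : form M α β < -1) : Disjoint (negHalf cs α) (negHalf cs β) := by
  rw [Set.disjoint_left]
  intro w h1 h2
  obtain ⟨γ, c, d, x, y, hγ, hinj, hpos, hc, hd, hsum, -, -⟩ := exists_isRoot_seq hα hβ h
  refine Set.infinite_range_of_injective hinj ((finite_inversionSet (cs := cs) w⁻¹).subset ?_)
  rintro _ ⟨n, rfl⟩
  obtain ⟨p, q, hp, hq, hn⟩ := hpos n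
  refine ⟨hγ n, ?_, ?_⟩
  · rw [hn]
    exact add_nonneg (smul_nonneg hp hα0) (smul_nonneg hq hβ0)
  · rw [hn, map_add, map_smul, map_smul]
    exact add_nonpos (smul_nonpos_of_nonneg_of_nonpos hp h1)
      (smul_nonpos_of_nonneg_of_nonpos hq h2)

/-- The ping-pong lemma for two group elements. -/
lemma exists_freeGroup_of_ping_pong {G : Type*} [Group G] (g h : G) {X Y Z T : Set G}
    (hX : X.Nonempty) (hZ : Z.Nonempty) (hXY : Disjoint X Y) (hXZ : Disjoint X Z)
    (hXT : Disjoint X T) (hYZ : Disjoint Y Z) (hYT : Disjoint Y T) (hZT : Disjoint Z T)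
    (hg : ∀ w ∉ Y, g * w ∈ X) (hg' : ∀ w ∉ X, g⁻¹ * w ∈ Y)
    (hh : ∀ w ∉ T, h * w ∈ Z) (hh' : ∀ w ∉ Z, h⁻¹ * w ∈ T) :
    ∃ f : FreeGroup (Fin 2) →* G, Function.Injective f := by
  let a : ULift (Fin 2) → G := ![g, h] ∘ ULift.down
  have hinj : Function.Injective (FreeGroup.lift a) := by
    refine FreeGroup.injective_lift_of_ping_pong a (![X, Z] ∘ ULift.down)
      (![Y, T] ∘ ULift.down) ?_ ?_ ?_ ?_ ?_ ?_
    · simpa [ULift.forall, Fin.forall_fin_two] using ⟨hX, hZ⟩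
    · simp [Pairwise, ULift.forall, Fin.forall_fin_two, Function.onFun, hXZ, hXZ.symm]
    · simp [Pairwise, ULift.forall, Fin.forall_fin_two, Function.onFun, hYT, hYT.symm]
    · simp [ULift.forall, Fin.forall_fin_two, hXY, hXT, hYZ.symm, hZT]
    · simpa [ULift.forall, Fin.forall_fin_two, Set.smul_set_subset_iff, a] using ⟨hg, hh⟩
    · simpa [ULift.forall, Fin.forall_fin_two, Set.smul_set_subset_iff, a] using ⟨hg', hh'⟩
  exact ⟨(FreeGroup.lift a).comp (FreeGroup.freeGroupCongr Equiv.ulift.symm).toMonoidHom,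
    hinj.comp (MulEquiv.injective _)⟩

/-- Three positive roots with pairwise products less than `-1` give a free subgroup, by
ping-pong. -/
lemma exists_freeGroup_of_triple {a b c : B → ℝ} (ha : IsRoot cs a) (hb : IsRoot cs b)
    (hc : IsRoot cs c) (ha0 : 0 ≤ a) (hb0 : 0 ≤ b) (hc0 : 0 ≤ c) (hab : form M a b < -1)
    (hac : form M a c < -1) (hbc : form M b c < -1) :
    ∃ f : FreeGroup (Fin 2) →* W, Function.Injective f := by
  have key : ∀ {γ : B → ℝ}, IsRoot cs γ → ∃ r : W, r⁻¹ = r ∧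
      ∀ w, w ∉ negHalf cs γ → r * w ∈ negHalf cs γ := by
    intro γ hγ
    obtain ⟨r, hr, hrx⟩ := hγ.exists_reflection
    refine ⟨r, inv_eq_of_mul_eq_one_left hr, fun w => hγ.mul_mem_negHalf
      (inv_eq_of_mul_eq_one_left hr) ?_⟩
    rw [hrx, hγ.form_self]; module
  have hone : ∀ {γ : B → ℝ}, IsRoot cs γ → 0 ≤ γ → (1 : W) ∉ negHalf cs γ := by
    intro γ hγ h0 h1
    refine hγ.ne_zero (le_antisymm ?_ h0)
    simpa [negHalf] using h1
  obtain ⟨r, hr, hrA⟩ := key ha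
  obtain ⟨s, hs, hsB⟩ := key hb
  obtain ⟨t, ht, htC⟩ := key hc
  have dab := Set.disjoint_left.1 (disjoint_negHalf ha hb ha0 hb0 hab)
  have dac := Set.disjoint_left.1 (disjoint_negHalf ha hc ha0 hc0 hac)
  have dbc := Set.disjoint_left.1 (disjoint_negHalf hb hc hb0 hc0 hbc)
  set A := negHalf cs a
  set B := negHalf cs b
  set C := negHalf cs c
  have hrr : ∀ w, r * (r * w) = w := fun w => by rw [← mul_assoc]; nth_rw 1 [← hr]; simp
  have hss : ∀ w, s * (s * w) = w := fun w => by rw [← mul_assoc]; nth_rw 1 [← hs]; simp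
  have htt : ∀ w, t * (t * w) = w := fun w => by rw [← mul_assoc]; nth_rw 1 [← ht]; simp
  have htC' : ∀ w, t * w ∉ C → w ∈ C := fun w hw => by simpa [htt] using htC _ hw
  refine exists_freeGroup_of_ping_pong (r * s) (t * (r * s) * t) (X := A) (Y := B)
    (Z := {w | t * w ∈ A}) (T := {w | t * w ∈ B}) ⟨r, by simpa using hrA 1 (hone ha ha0)⟩
    ⟨t * r, by simpa [htt] using hrA 1 (hone ha ha0)⟩ (Set.disjoint_left.2 dab)
    (Set.disjoint_left.2 fun w h1 h2 => dac h1 (htC' w (dac h2)))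
    (Set.disjoint_left.2 fun w h1 h2 => dac h1 (htC' w (dbc h2)))
    (Set.disjoint_left.2 fun w h1 h2 => dbc h1 (htC' w (dac h2)))
    (Set.disjoint_left.2 fun w h1 h2 => dbc h1 (htC' w (dbc h2)))
    (Set.disjoint_left.2 fun w h1 h2 => dab h1 h2) ?_ ?_ ?_ ?_
  · intro w hw
    rw [mul_assoc]
    exact hrA _ fun h => dab h (hsB w hw)
  · intro w hw
    rw [mul_inv_rev, hr, hs, mul_assoc]
    exact hsB _ (dab (hrA w hw))
  · intro w hw
    simp only [Set.mem_ofPred_eq, mul_assoc, htt] at hw ⊢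
    exact hrA _ fun h => dab h (hsB _ hw)
  · intro w hw
    simp only [Set.mem_ofPred_eq, mul_inv_rev, hr, hs, ht, mul_assoc, htt] at hw ⊢
    exact hsB _ (dab (hrA _ hw))

end PingPong

section Indefinite

variable {B : Type*} [Fintype B] [DecidableEq B] {M : CoxeterMatrix B}
  {W : Type*} [Group W] {cs : CoxeterSystem M W}

lemma eventually_nonneg_rep {γ : ℕ → B → ℝ} {c d : ℕ → ℝ} {x y : B → ℝ} {s : B}
    (hγ : ∀ n, IsRoot cs (γ n)) (hinj : Function.Injective γ) (hc : Tendsto c atTop atTop)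
    (hd : Tendsto d atTop (𝓝 0)) (hsum : ∀ n, γ n = c n • x + d n • y) (hs : 0 < x s) (w : W) :
    ∀ᶠ n in atTop, 0 ≤ rep cs w (γ n) := by
  have h1 : Tendsto (fun n => γ n s) atTop atTop := by
    have := (hc.atTop_mul_const hs).atTop_add (hd.mul_const (y s))
    simpa [hsum] using this
  have h2 : ∀ᶠ n in atTop, γ n ∉ inversionSet cs w := by
    rw [← Nat.cofinite_eq_atTop]
    exact hinj.tendsto_cofinite.eventually (finite_inversionSet w).compl_mem_cofinite
  filter_upwards [h1.eventually_gt_atTop 0, h2] with n hn hn'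
  have h3 : 0 ≤ γ n := (hγ n).nonneg_or.resolve_right fun h => absurd (h s) (not_le.2 hn)
  exact ((hγ n).rep w).nonneg_or.resolve_right fun h => hn' ⟨hγ n, h3, h⟩

lemma eventually_form_lt {c d : ℕ → ℝ} {x y x' y' : B → ℝ}
    (hc : Tendsto c atTop atTop) (hd : Tendsto d atTop (𝓝 0)) (h : form M x x' < 0) :
    ∀ᶠ n in atTop, form M (c n • x + d n • y) (c n • x' + d n • y') < -1 := by
  have h1 : Tendsto (fun n => c n * (c n * form M x x' + d n * (form M x y' + form M y x')) +
      d n * d n * form M y y') atTop atBot := by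
    have h2 := (hc.atTop_mul_const_of_neg h).atBot_add
      (hd.mul_const (form M x y' + form M y x'))
    exact (hc.atTop_mul_atBot₀ h2).atBot_add ((hd.mul hd).mul_const (form M y y'))
  filter_upwards [h1.eventually_lt_atBot (-1)] with n hn
  refine lt_of_eq_of_lt ?_ hn
  simp only [map_add, map_smul, LinearMap.add_apply, LinearMap.smul_apply, smul_eq_mul]
  ring

lemma exists_freeGroup_of_seq {γ : ℕ → B → ℝ} {c d : ℕ → ℝ} {x y : B → ℝ} {s : B}
    (hγ : ∀ n, IsRoot cs (γ n)) (hinj : Function.Injective γ) (hc : Tendsto c atTop atTop)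
    (hd : Tendsto d atTop (𝓝 0)) (hsum : ∀ n, γ n = c n • x + d n • y) (hs : 0 < x s)
    (hxx : form M x x = 0) (hxy : form M x y < 0) :
    ∃ f : FreeGroup (Fin 2) →* W, Function.Injective f := by
  by_contra hF
  have htriple : ∀ w v : W, form M x (rep cs w x) < 0 → form M x (rep cs v x) < 0 →
      0 ≤ form M (rep cs w x) (rep cs v x) := by
    intro w v h1 h2
    by_contra! h3
    have hexp : ∀ (u : W) n, rep cs u (γ n) = c n • rep cs u x + d n • rep cs u y := by
      intro u n; rw [hsum, map_add, map_smul, map_smul]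
    obtain ⟨n, p1, p2, p3, p4, p5, p6⟩ :=
      ((eventually_nonneg_rep hγ hinj hc hd hsum hs 1).and <|
      (eventually_nonneg_rep hγ hinj hc hd hsum hs w).and <|
      (eventually_nonneg_rep hγ hinj hc hd hsum hs v).and <|
      (eventually_form_lt (y := y) (y' := rep cs w y) hc hd h1).and <|
      (eventually_form_lt (y := y) (y' := rep cs v y) hc hd h2).and
      (eventually_form_lt (y := rep cs w y) (y' := rep cs v y) hc hd h3)).exists
    rw [rep_one_apply] at p1
    rw [← hexp, ← hsum] at p4 p5
    rw [← hexp, ← hexp] at p6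
    exact hF (exists_freeGroup_of_triple (hγ n) ((hγ n).rep w) ((hγ n).rep v) p1 p2 p3 p4 p5 p6)
  have hkey : ∀ {α β : B → ℝ}, IsRoot cs α → IsRoot cs β → form M α x ≠ 0 → form M β x ≠ 0 →
      form M α x ^ 2 + form M β x ^ 2 ≤ 2 * form M α x * form M β x * form M α β := by
    intro α β hα hβ h1 h2
    obtain ⟨r, -, hr⟩ := hα.exists_reflection
    obtain ⟨t, -, ht⟩ := hβ.exists_reflection
    have h3 := htriple r t
    simp only [hr, ht, map_sub, map_smul, LinearMap.sub_apply, LinearMap.smul_apply, smul_eq_mul,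
      hxx, form_symm M x α, form_symm M x β] at h3
    have h4 := h3 (by have := sq_pos_of_ne_zero h1; linarith)
      (by have := sq_pos_of_ne_zero h2; linarith)
    linarith
  obtain ⟨σ, hσ⟩ : ∃ σ, form M (simpleRoot σ) x ≠ 0 := by
    by_contra! hcon
    rw [form_eq_sum] at hxy
    simp [form_symm M x, hcon] at hxy
  have hall : ∀ t, form M (simpleRoot t) x = gram M σ t * form M (simpleRoot σ) x := by
    intro t
    rcases eq_or_ne σ t with rfl | ht
    · rw [gram_self, one_mul]
    have hG0 := gram_nonpos M ht
    have hG1 := neg_one_le_gram M σ t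
    by_cases h0 : form M (simpleRoot t) x = 0
    · have h1 := hkey (isRoot_simpleRoot (cs := cs) σ)
        ((isRoot_simpleRoot (cs := cs) σ).rep (cs.simple t)) hσ
      simp only [rep_simple, refl_apply, map_sub, map_smul, LinearMap.sub_apply,
        LinearMap.smul_apply, smul_eq_mul, h0, form_simpleRoot, gram_self, gram_symm M t σ,
        mul_zero, sub_zero] at h1
      have h2 := h1 hσ
      have h3 := sq_pos_of_ne_zero hσ
      have h4 : gram M σ t = 0 := by
        by_contra h5
        have h6 := sq_pos_of_ne_zero h5
        nlinarith [mul_pos h3 h6]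
      rw [h0, h4, zero_mul]
    · have h1 := hkey (isRoot_simpleRoot (cs := cs) σ) (isRoot_simpleRoot (cs := cs) t) hσ h0
      rw [form_simpleRoot] at h1
      set g := form M (simpleRoot σ) x
      set e := form M (simpleRoot t) x
      have h3 := sq_pos_of_ne_zero hσ
      have hge : g * e < 0 := by
        by_contra! hcon
        nlinarith [mul_nonneg hcon (neg_nonneg.2 hG0), sq_nonneg e]
      have h4 : g + e = 0 := by
        have : (g + e) ^ 2 ≤ 0 := by
          nlinarith [mul_nonneg (neg_nonneg.2 hge.le) (by linarith : 0 ≤ gram M σ t + 1)]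
        exact pow_eq_zero_iff two_ne_zero |>.1 (le_antisymm this (sq_nonneg _))
      have h5 : e = -g := by linarith
      have h6 : gram M σ t = -1 := by
        rw [h5] at h1
        nlinarith
      rw [h5, h6]; ring
  have h1 : form M (simpleRoot σ) x = ∑ t, x t * gram M σ t := by
    rw [form_eq_sum]
    simp only [form_simpleRoot]
  have h2 : form M x x = (∑ t, x t * gram M σ t) * form M (simpleRoot σ) x := by
    rw [form_eq_sum, Finset.sum_mul]
    refine Finset.sum_congr rfl fun t _ => ?_
    rw [form_symm M x, hall, mul_assoc]
  rw [← h1, hxx] at h2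
  exact hσ (mul_self_eq_zero.1 h2.symm)

/-- If two roots have product of absolute value greater than `1` then the Coxeter group contains
a nonabelian free subgroup. -/
lemma exists_freeGroup_of_one_lt_abs_form {α β : B → ℝ} (hα : IsRoot cs α) (hβ : IsRoot cs β)
    (h : 1 < |form M α β|) : ∃ f : FreeGroup (Fin 2) →* W, Function.Injective f := by
  wlog hlt : form M α β < -1 generalizing β
  · refine this hβ.neg (by simpa using h) ?_
    rw [map_neg]
    rcases lt_abs.1 h with h | h <;> linarith
  obtain ⟨γ, c, d, x, y, hγ, hinj, -, hc, hd, hsum, hxx, hxy⟩ := exists_isRoot_seq hα hβ hlt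
  obtain ⟨s, hs⟩ : ∃ s, x s ≠ 0 := by
    by_contra! hcon
    have : x = 0 := funext hcon
    simp [this] at hxy
  rcases hs.lt_or_gt with hs | hs
  · refine exists_freeGroup_of_seq (γ := fun n => -γ n) (x := -x) (y := -y) (s := s)
      (fun n => (hγ n).neg) (neg_injective.comp hinj) hc hd (fun n => ?_) (by simpa using hs)
      (by simpa using hxx) (by simpa using hxy)
    rw [hsum]; module
  · exact exists_freeGroup_of_seq hγ hinj hc hd hsum hs hxx hxy

end Indefinite

section FiniteSubgroup

variable {B : Type*} [Fintype B] [DecidableEq B] {M : CoxeterMatrix B}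
  {W : Type*} [Group W] {cs : CoxeterSystem M W}

lemma eq_one_of_norm_sub_lt {w : W} (h : ∀ s, ‖rep cs w (simpleRoot s) - simpleRoot s‖ < 1) :
    w = 1 := by
  refine eq_one_of_rep_simpleRoot (cs := cs) fun s => ?_
  have hco : ∀ t, |rep cs w (simpleRoot s) t - simpleRoot s t| < 1 := fun t =>
    (norm_le_pi_norm (rep cs w (simpleRoot s) - simpleRoot s) t).trans_lt (h s)
  have hr := (isRoot_simpleRoot (cs := cs) s).rep w
  have hpos : 0 < rep cs w (simpleRoot s) s := by
    have := (abs_lt.1 (hco s)).1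
    simp only [simpleRoot, Pi.single_eq_same] at this ⊢
    linarith
  rcases hr.isAdmissible_or with h1 | h1
  · refine hr.eq_simpleRoot h1.nonneg fun t ht => (h1 t).resolve_right fun h2 => ?_
    have := (abs_lt.1 (hco t)).2
    simp only [simpleRoot, Pi.single_eq_of_ne ht] at this h2
    linarith
  · have := h1.nonneg s
    simp only [Pi.zero_apply, Pi.neg_apply] at this
    linarith

lemma norm_le_of_norm_rep_le {w : W} {R : ℝ} (h : ∀ s, ‖rep cs w (simpleRoot s)‖ ≤ R)
    (v : B → ℝ) : ‖rep cs w v‖ ≤ Fintype.card B * R * ‖v‖ := by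
  conv_lhs => rw [eq_sum_simpleRoot v]
  rw [map_sum]
  have : ∀ s ∈ Finset.univ, ‖rep cs w (v s • simpleRoot s)‖ ≤ ‖v‖ * R := fun s _ => by
    rw [map_smul, norm_smul]
    exact mul_le_mul (norm_le_pi_norm v s) (h s) (norm_nonneg _) (norm_nonneg _)
  refine (norm_sum_le_of_le _ this).trans (le_of_eq ?_)
  simp
  ring

/-- A subgroup which acts boundedly in the geometric representation is finite. -/
lemma finite_of_norm_rep_le {D : Subgroup W} {R : ℝ}
    (h : ∀ w ∈ D, ∀ s, ‖rep cs w (simpleRoot s)‖ ≤ R) : Finite D := by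
  by_contra hinf
  rw [not_finite_iff_infinite] at hinf
  let g := Infinite.natEmbedding D
  let F : ℕ → B → B → ℝ := fun n s => rep cs (g n : W) (simpleRoot s)
  have hF : ∀ n, F n ∈ Metric.closedBall (0 : B → B → ℝ) |R| := fun n => by
    rw [mem_closedBall_zero_iff, pi_norm_le_iff_of_nonneg (abs_nonneg R)]
    exact fun s => (h _ (g n).2 s).trans (le_abs_self R)
  obtain ⟨a, -, φ, hφ, ha⟩ := tendsto_subseq_of_bounded Metric.isBounded_closedBall hF
  have hε : (0 : ℝ) < 1 / (Fintype.card B * |R| + 1) := by positivity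
  obtain ⟨N, hN⟩ := Metric.cauchySeq_iff.1 ha.cauchySeq _ hε
  have hlt := hN (N + 1) (by simp) N le_rfl
  have hne : (g (φ (N + 1)) : W) ≠ g (φ N) := fun heq => by
    have := hφ.injective (g.injective (Subtype.ext heq))
    omega
  refine hne (inv_mul_eq_one.1 (eq_one_of_norm_sub_lt (cs := cs)
    (w := (g (φ N) : W)⁻¹ * g (φ (N + 1))) fun s => ?_)).symm
  have h1 : rep cs ((g (φ N) : W)⁻¹ * g (φ (N + 1))) (simpleRoot s) - simpleRoot s =
      rep cs (g (φ N) : W)⁻¹ (F (φ (N + 1)) s - F (φ N) s) := by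
    rw [map_sub, rep_inv_apply_apply, rep_mul_apply]
  have h2 : ‖F (φ (N + 1)) s - F (φ N) s‖ < 1 / (Fintype.card B * |R| + 1) :=
    (norm_le_pi_norm (F (φ (N + 1)) - F (φ N)) s).trans_lt (by rwa [dist_eq_norm] at hlt)
  rw [h1]
  refine (norm_le_of_norm_rep_le (R := |R|)
    (fun s => (h _ (D.inv_mem (g (φ N)).2) s).trans (le_abs_self R)) _).trans_lt ?_
  rw [lt_div_iff₀ (by positivity)] at h2
  nlinarith [norm_nonneg (F (φ (N + 1)) s - F (φ N) s), abs_nonneg R]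

/-- The subgroup generated by the reflections in two roots whose product has absolute value
less than `1` is finite. -/
lemma exists_finite_subgroup {α β : B → ℝ} (hα : IsRoot cs α) (hβ : IsRoot cs β)
    (h : |form M α β| < 1) : ∃ D : Subgroup W, Finite D ∧
      (∃ r ∈ D, rep cs r α = -α) ∧ ∃ r ∈ D, rep cs r β = -β := by
  obtain ⟨r, hr1, hr⟩ := hα.exists_reflection
  obtain ⟨t, ht1, ht⟩ := hβ.exists_reflection
  set a := form M α β with ha
  have hαα := hα.form_self
  have hββ := hβ.form_self
  have hβα : form M β α = a := by rw [form_symm]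
  have ha2 : 0 < 1 - a ^ 2 := by
    have := abs_lt.1 h
    nlinarith
  let D : Subgroup W := Subgroup.closure {r, t}
  have hrD : r ∈ D := Subgroup.subset_closure (by simp)
  have htD : t ∈ D := Subgroup.subset_closure (by simp)
  have hgen : ∀ x ∈ ({r, t} : Set W), ∀ p q : ℝ, ∃ p' q' : ℝ,
      rep cs x (p • α + q • β) = p' • α + q' • β := by
    rintro x (rfl | rfl) p q
    · refine ⟨-p - 2 * a * q, q, ?_⟩
      simp only [hr, map_add, map_smul, hαα, ← ha, smul_eq_mul]
      module
    · refine ⟨p, -q - 2 * a * p, ?_⟩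
      simp only [ht, map_add, map_smul, hββ, hβα, smul_eq_mul]
      module
  have hplane : ∀ w ∈ D, ∀ p q : ℝ, ∃ p' q' : ℝ,
      rep cs w (p • α + q • β) = p' • α + q' • β := by
    intro w hw
    induction hw using Subgroup.closure_induction_left with
    | one => exact fun p q => ⟨p, q, rep_one_apply _ _⟩
    | mul_left x hx y hy ih =>
      intro p q
      obtain ⟨p', q', h1⟩ := ih p q
      rw [rep_mul_apply, h1]
      exact hgen x hx p' q'
    | inv_mul_cancel x hx y hy ih =>
      intro p q
      obtain ⟨p', q', h1⟩ := ih p q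
      have hinv : x⁻¹ = x := by
        rcases hx with rfl | rfl
        · exact inv_eq_of_mul_eq_one_left hr1
        · exact inv_eq_of_mul_eq_one_left ht1
      rw [rep_mul_apply, h1, hinv]
      exact hgen x hx p' q'
  have hperp : ∀ w ∈ D, ∀ v, form M α v = 0 → form M β v = 0 → rep cs w v = v := by
    intro w hw v h1 h2
    induction hw using Subgroup.closure_induction with
    | mem x hx =>
      rcases hx with rfl | rfl
      · simp [hr, h1]
      · simp [ht, h2]
    | one => exact rep_one_apply _ _
    | mul x y _ _ hx hy => rw [rep_mul_apply, hy, hx]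
    | inv x _ hx => nth_rw 1 [← hx]; exact rep_inv_apply_apply cs x v
  have hform : ∀ p q : ℝ, form M (p • α + q • β) (p • α + q • β) =
      p ^ 2 + q ^ 2 + 2 * a * p * q := by
    intro p q
    simp only [map_add, LinearMap.add_apply, map_smul, LinearMap.smul_apply, smul_eq_mul, hαα, hββ,
      hβα, ← ha]
    ring
  have hbound : ∀ w ∈ D, ∀ p q : ℝ, ‖rep cs w (p • α + q • β)‖ ≤
      ((p ^ 2 + q ^ 2 + 2 * a * p * q) / (1 - a ^ 2) + 1) * (‖α‖ + ‖β‖) := by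
    intro w hw p q
    obtain ⟨p', q', h1⟩ := hplane w hw p q
    have h2 := form_rep_rep cs w (p • α + q • β) (p • α + q • β)
    rw [h1, hform, hform] at h2
    rw [h1, ← h2]
    have habs : ∀ z C : ℝ, z ^ 2 ≤ C → |z| ≤ C + 1 := fun z C hz => by
      rw [← sq_abs] at hz
      nlinarith [sq_nonneg (|z| - 1)]
    have hp : |p'| ≤ _ := habs p' ((p' ^ 2 + q' ^ 2 + 2 * a * p' * q') / (1 - a ^ 2)) (by
      rw [le_div_iff₀ ha2]; nlinarith [sq_nonneg (q' + a * p')])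
    have hq : |q'| ≤ _ := habs q' ((p' ^ 2 + q' ^ 2 + 2 * a * p' * q') / (1 - a ^ 2)) (by
      rw [le_div_iff₀ ha2]; nlinarith [sq_nonneg (p' + a * q')])
    refine (norm_add_le _ _).trans ?_
    rw [norm_smul, norm_smul, mul_add, Real.norm_eq_abs, Real.norm_eq_abs]
    exact add_le_add (mul_le_mul_of_nonneg_right hp (norm_nonneg _))
      (mul_le_mul_of_nonneg_right hq (norm_nonneg _))
  have hvec : ∀ v : B → ℝ, ∃ R, ∀ w ∈ D, ‖rep cs w v‖ ≤ R := by
    intro v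
    let p := (form M α v - a * form M β v) / (1 - a ^ 2)
    let q := (form M β v - a * form M α v) / (1 - a ^ 2)
    have hpq1 : p + a * q = form M α v := by simp only [p, q]; field_simp; ring
    have hpq2 : a * p + q = form M β v := by simp only [p, q]; field_simp; ring
    obtain ⟨u, hu⟩ : ∃ u, v = (p • α + q • β) + u := ⟨v - (p • α + q • β), by abel⟩
    have hu' : u = v - (p • α + q • β) := by rw [hu]; abel
    refine ⟨((p ^ 2 + q ^ 2 + 2 * a * p * q) / (1 - a ^ 2) + 1) * (‖α‖ + ‖β‖) + ‖u‖,
      fun w hw => ?_⟩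
    have h1 : rep cs w u = u := by
      refine hperp w hw u ?_ ?_
      · simp only [hu', map_sub, map_add, map_smul, hαα, ← ha, smul_eq_mul]
        linarith
      · simp only [hu', map_sub, map_add, map_smul, hββ, hβα, smul_eq_mul]
        linarith
    rw [hu, map_add, h1]
    exact (norm_add_le _ _).trans (add_le_add_left (hbound w hw p q) _)
  choose R hR using fun s : B => hvec (simpleRoot s)
  obtain ⟨C, hC⟩ := (Set.finite_range R).bddAbove
  refine ⟨D, finite_of_norm_rep_le (cs := cs) (R := C) fun w hw s =>
    (hR s w hw).trans (hC ⟨s, rfl⟩), ⟨r, hrD, ?_⟩, t, htD, ?_⟩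
  · rw [hr, hαα]; module
  · rw [ht, hββ]; module

end FiniteSubgroup

section FiniteProducts

variable {B : Type*} [Fintype B] [DecidableEq B] {M : CoxeterMatrix B}
  {W : Type*} [Group W] {cs : CoxeterSystem M W}

/-- If a linear functional is negative on only finitely many positive roots then some translate of
it is nonnegative on all simple roots. -/
lemma exists_rep_simpleRoot_nonneg (f : (B → ℝ) →ₗ[ℝ] ℝ)
    (hf : {γ | IsRoot cs γ ∧ 0 ≤ γ ∧ f γ < 0}.Finite) :
    ∃ w : W, ∀ s, 0 ≤ f (rep cs w (simpleRoot s)) := by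
  induction hn : {γ | IsRoot cs γ ∧ 0 ≤ γ ∧ f γ < 0}.ncard using Nat.strong_induction_on
    generalizing f with
  | _ n ih =>
    by_cases hall : ∀ s, 0 ≤ f (simpleRoot s)
    · exact ⟨1, fun s => by rw [rep_one_apply]; exact hall s⟩
    push Not at hall
    obtain ⟨s, hs⟩ := hall
    let g : (B → ℝ) →ₗ[ℝ] ℝ := f ∘ₗ rep cs (cs.simple s)
    have hself : ∀ γ, rep cs (cs.simple s) (rep cs (cs.simple s) γ) = γ := fun γ => by
      rw [← rep_mul_apply, cs.simple_mul_simple_self, rep_one_apply]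
    have hsub : rep cs (cs.simple s) '' {γ | IsRoot cs γ ∧ 0 ≤ γ ∧ g γ < 0} ⊂
        {γ | IsRoot cs γ ∧ 0 ≤ γ ∧ f γ < 0} := by
      rw [Set.ssubset_iff_of_subset]
      · refine ⟨simpleRoot s, ⟨isRoot_simpleRoot s, ?_, hs⟩, ?_⟩
        · exact (isAdmissible_simpleRoot s).nonneg
        · rintro ⟨γ, ⟨h1, h2, h3⟩, h4⟩
          have h5 : γ = -simpleRoot s := by
            rw [← hself γ, h4, rep_simple_simpleRoot_self]
          have h6 := h2 s
          simp [h5, simpleRoot] at h6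
          linarith
      · rintro _ ⟨γ, ⟨h1, h2, h3⟩, rfl⟩
        refine ⟨h1.rep _, h1.rep_simple_nonneg h2 ?_, h3⟩
        rintro rfl
        have h4 : f (-simpleRoot s) < 0 := by rwa [← rep_simple_simpleRoot_self (cs := cs)]
        rw [map_neg] at h4
        linarith
    have hinj : Function.Injective (rep cs (cs.simple s)) :=
      Function.LeftInverse.injective hself
    have hlt := Set.ncard_lt_ncard hsub hf
    rw [Set.ncard_image_of_injective _ hinj, hn] at hlt
    obtain ⟨w, hw⟩ := ih _ hlt g
      ((hf.subset hsub.subset).of_finite_image hinj.injOn) rfl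
    exact ⟨cs.simple s * w, fun t => by rw [rep_mul_apply]; exact hw t⟩

variable (cs) in
/-- The roots supported in a set of generators. -/
def rootsIn (T : Set B) : Set (B → ℝ) := {γ | IsRoot cs γ ∧ ∀ s ∉ T, γ s = 0}

lemma IsRoot.sum_pos {γ : B → ℝ} (h : IsRoot cs γ) (h0 : 0 ≤ γ) : 0 < ∑ s, γ s := by
  refine lt_of_le_of_ne (Finset.sum_nonneg fun s _ => h0 s) fun hsum => h.ne_zero ?_
  have := (Finset.sum_eq_zero_iff_of_nonneg fun s _ => h0 s).1 hsum.symm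
  exact funext fun s => this s (Finset.mem_univ s)

lemma exists_mem_rootsIn {α β : B → ℝ} (hα : IsRoot cs α) (hβ : IsRoot cs β)
    (h : |form M α β| < 1) : ∃ T : Set B, (rootsIn cs T).Finite ∧
      ∃ α' ∈ rootsIn cs T, ∃ β' ∈ rootsIn cs T, form M α' β' = form M α β := by
  obtain ⟨D, hD, ⟨r, hrD, hr⟩, t, htD, ht⟩ := exists_finite_subgroup hα hβ h
  have := Fintype.ofFinite D
  let height : (B → ℝ) →ₗ[ℝ] ℝ := ∑ s, LinearMap.proj s
  let f : (B → ℝ) →ₗ[ℝ] ℝ := ∑ d : D, height ∘ₗ rep cs (d : W)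
  have hf : ∀ v, f v = ∑ d : D, ∑ s, rep cs (d : W) v s := fun v => by
    simp [f, height, LinearMap.sum_apply]
  have hinv : ∀ d ∈ D, ∀ v, f (rep cs d v) = f v := by
    intro d hd v
    rw [hf, hf]
    refine Fintype.sum_equiv (Equiv.mulRight (⟨d, hd⟩ : D)) _ _ fun e => ?_
    simp
  have hzero : ∀ {γ : B → ℝ}, (∃ r ∈ D, rep cs r γ = -γ) → f γ = 0 := by
    rintro γ ⟨r, hr, h1⟩
    have := hinv r hr γ
    rw [h1, map_neg] at this
    linarith
  have hfin : {γ | IsRoot cs γ ∧ 0 ≤ γ ∧ f γ ≤ 0}.Finite := by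
    refine (Set.finite_iUnion fun d : D => finite_inversionSet (cs := cs) (d : W)).subset ?_
    rintro γ ⟨h1, h2, h3⟩
    by_contra hcon
    simp only [Set.mem_iUnion, not_exists] at hcon
    have h4 : 0 < f γ := by
      rw [hf]
      refine Finset.sum_pos (fun d _ => (h1.rep d).sum_pos ?_) ⟨1, Finset.mem_univ _⟩
      exact (h1.rep _).nonneg_or.resolve_right fun h => hcon d ⟨h1, h2, h⟩
    linarith
  obtain ⟨w, hw⟩ := exists_rep_simpleRoot_nonneg (cs := cs) f
    (hfin.subset fun γ hγ => ⟨hγ.1, hγ.2.1, hγ.2.2.le⟩)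
  let T : Set B := {s | f (rep cs w (simpleRoot s)) = 0}
  have hexp : ∀ v, f (rep cs w v) = ∑ s, v s * f (rep cs w (simpleRoot s)) := fun v => by
    conv_lhs => rw [eq_sum_simpleRoot v]
    simp [map_sum]
  have hpos : {γ | γ ∈ rootsIn cs T ∧ 0 ≤ γ}.Finite := by
    refine ((hfin.image (rep cs w⁻¹)).union (finite_inversionSet (cs := cs) w)).subset ?_
    rintro γ ⟨⟨h1, h2⟩, h3⟩
    have h4 : f (rep cs w γ) = 0 := by
      rw [hexp]
      refine Finset.sum_eq_zero fun s _ => ?_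
      by_cases hs : s ∈ T
      · rw [show f (rep cs w (simpleRoot s)) = 0 from hs, mul_zero]
      · rw [h2 s hs, zero_mul]
    rcases (h1.rep w).nonneg_or with h5 | h5
    · exact Or.inl ⟨rep cs w γ, ⟨h1.rep w, h5, h4.le⟩, rep_inv_apply_apply cs w γ⟩
    · exact Or.inr ⟨h1, h3, h5⟩
  have hmem : ∀ {γ : B → ℝ}, IsRoot cs γ → f γ = 0 → rep cs w⁻¹ γ ∈ rootsIn cs T := by
    intro γ hγ h0
    refine ⟨hγ.rep _, fun s hs => ?_⟩
    have h1 : ∑ s, rep cs w⁻¹ γ s * f (rep cs w (simpleRoot s)) = 0 := by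
      rw [← hexp, rep_apply_inv_apply, h0]
    have h2 : rep cs w⁻¹ γ s * f (rep cs w (simpleRoot s)) = 0 := by
      rcases (hγ.rep w⁻¹).nonneg_or with h3 | h3
      · exact (Finset.sum_eq_zero_iff_of_nonneg fun s _ => mul_nonneg (h3 s) (hw s)).1 h1 s
          (Finset.mem_univ s)
      · exact (Finset.sum_eq_zero_iff_of_nonpos fun s _ =>
          mul_nonpos_of_nonpos_of_nonneg (h3 s) (hw s)).1 h1 s (Finset.mem_univ s)
    exact (mul_eq_zero.1 h2).resolve_right hs
  refine ⟨T, (hpos.union (hpos.image Neg.neg)).subset ?_, _, hmem hα (hzero ⟨r, hrD, hr⟩), _,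
    hmem hβ (hzero ⟨t, htD, ht⟩), form_rep_rep cs _ _ _⟩
  rintro γ ⟨h1, h2⟩
  rcases h1.nonneg_or with h3 | h3
  · exact Or.inl ⟨⟨h1, h2⟩, h3⟩
  · exact Or.inr ⟨-γ, ⟨⟨h1.neg, fun s hs => by simp [h2 s hs]⟩, neg_nonneg.2 h3⟩, neg_neg γ⟩

variable (cs) in
/-- The products of roots take only finitely many values in the interval `(-1, 1)`. -/
lemma finite_form_of_abs_lt_one :
    {r | |r| < 1 ∧ ∃ α β, IsRoot cs α ∧ IsRoot cs β ∧ form M α β = r}.Finite := by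
  refine (Set.finite_iUnion fun T : Set B => Set.finite_iUnion
    fun h : (rootsIn cs T).Finite => h.image2 (fun α β => form M α β) h).subset ?_
  rintro _ ⟨h, α, β, hα, hβ, rfl⟩
  obtain ⟨T, hT, α', hα', β', hβ', h'⟩ := exists_mem_rootsIn hα hβ h
  simp only [Set.mem_iUnion]
  exact ⟨T, hT, α', hα', β', hβ', h'⟩

end FiniteProducts

section Translations

variable {B : Type*} [Fintype B] [DecidableEq B] {M : CoxeterMatrix B}
  {W : Type*} [Group W] {cs : CoxeterSystem M W}

variable (cs) in
/-- The elements which act trivially modulo the radical of the standard bilinear form. -/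
def translations : Subgroup W where
  carrier := {w | ∀ v y, form M (rep cs w v) y = form M v y}
  one_mem' v y := by rw [rep_one_apply]
  mul_mem' {a b} ha hb v y := by rw [rep_mul_apply, ha, hb]
  inv_mem' {a} ha v y := by rw [← ha (rep cs a⁻¹ v), rep_apply_inv_apply]

lemma rep_eq_self_of_form_eq_zero {r : B → ℝ} (hr : ∀ y, form M r y = 0) (w : W) :
    rep cs w r = r := by
  induction w using cs.simple_induction with
  | simple s => rw [rep_simple, refl_apply, form_symm, hr]; simp
  | one => exact rep_one_apply _ _
  | mul v w hv hw => rw [rep_mul_apply, hw, hv]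

lemma rep_mul_of_mem_translations {w : W} (hw : w ∈ translations cs) (u : W) (v : B → ℝ) :
    rep cs (u * w) v = rep cs u v + (rep cs w v - v) := by
  have h : rep cs u (rep cs w v - v) = rep cs w v - v :=
    rep_eq_self_of_form_eq_zero (fun y => by rw [map_sub, LinearMap.sub_apply, hw, sub_self]) u
  rw [rep_mul_apply, ← sub_eq_iff_eq_add', ← map_sub, h]

lemma eq_of_rep_apply_eq {u w : W} (h : ∀ v, rep cs u v = rep cs w v) : u = w := by
  refine (inv_mul_eq_one.1 (eq_one_of_rep_simpleRoot (cs := cs) fun s => ?_)).symm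
  rw [rep_mul_apply, h, rep_inv_apply_apply]

lemma mul_comm_of_mem_translations {u w : W} (hu : u ∈ translations cs)
    (hw : w ∈ translations cs) : u * w = w * u := by
  refine eq_of_rep_apply_eq (cs := cs) fun v => ?_
  rw [rep_mul_of_mem_translations hw, rep_mul_of_mem_translations hu]
  abel

lemma rep_pow_of_mem_translations {w : W} (hw : w ∈ translations cs) (n : ℕ) (v : B → ℝ) :
    rep cs (w ^ n) v = v + (n : ℝ) • (rep cs w v - v) := by
  induction n with
  | zero => simp
  | succ n ih =>
    rw [pow_succ, rep_mul_of_mem_translations hw, ih]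
    push_cast
    module

lemma eq_one_of_pow_eq_one {w : W} (hw : w ∈ translations cs) {n : ℕ} (hn : n ≠ 0)
    (h : w ^ n = 1) : w = 1 := by
  refine eq_of_rep_apply_eq (cs := cs) fun v => ?_
  have h1 := rep_pow_of_mem_translations hw n v
  rw [h, rep_one_apply, left_eq_add, smul_eq_zero, sub_eq_zero] at h1
  rw [rep_one_apply]
  exact h1.resolve_left (by exact_mod_cast hn)

lemma finiteIndex_translations (hfree : ¬ ∃ f : FreeGroup (Fin 2) →* W, Function.Injective f) :
    (translations cs).FiniteIndex := by
  let Φ : W → B → B → ℝ := fun w s t => form M (rep cs w (simpleRoot s)) (simpleRoot t)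
  have hΦ : (Set.range Φ).Finite := by
    have hV := (finite_form_of_abs_lt_one cs).union (Set.toFinite {1, -1})
    refine (Set.Finite.pi' fun _ : B => Set.Finite.pi' fun _ : B => hV).subset ?_
    rintro _ ⟨w, rfl⟩ s t
    have hs := (isRoot_simpleRoot (cs := cs) s).rep w
    have ht := isRoot_simpleRoot (cs := cs) t
    have hle : |Φ w s t| ≤ 1 :=
      not_lt.1 fun h => hfree (exists_freeGroup_of_one_lt_abs_form hs ht h)
    rcases hle.lt_or_eq with h | h
    · exact Or.inl ⟨h, _, _, hs, ht, rfl⟩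
    · exact Or.inr (eq_or_eq_neg_of_abs_eq h)
  have key : ∀ u w, Φ u = Φ w → u⁻¹ * w ∈ translations cs := by
    intro u w h v y
    have h1 : ∀ s z, form M (rep cs u (simpleRoot s)) z = form M (rep cs w (simpleRoot s)) z := by
      intro s z
      rw [form_eq_sum, form_eq_sum M (rep cs w (simpleRoot s))]
      exact Finset.sum_congr rfl fun t _ => congrArg (z t * ·) (congrFun (congrFun h s) t)
    have h2 : form M (rep cs u v) (rep cs u y) = form M (rep cs w v) (rep cs u y) := by
      rw [eq_sum_simpleRoot v]
      simp only [map_sum, map_smul, LinearMap.sum_apply, LinearMap.smul_apply, h1]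
    rw [rep_mul_apply, form_rep_left, inv_inv, ← h2, form_rep_rep]
  have := hΦ.to_subtype
  have : Finite (W ⧸ translations cs) := by
    refine Finite.of_injective
      (fun q : W ⧸ translations cs => (⟨Φ q.out, ⟨_, rfl⟩⟩ : Set.range Φ)) fun p q h => ?_
    have h1 := key _ _ (congrArg Subtype.val h)
    rw [← QuotientGroup.eq, QuotientGroup.out_eq', QuotientGroup.out_eq'] at h1
    exact h1
  exact Subgroup.finiteIndex_of_finite_quotient

end Translations

section Components

/-- A finitely generated torsion-free commutative group is free abelian of finite rank. -/
lemma exists_mulEquiv_multiplicative (H : Type*) [CommGroup H] [Group.FG H]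
    (htf : ∀ (x : H) (n : ℕ), n ≠ 0 → x ^ n = 1 → x = 1) :
    ∃ n : ℕ, Nonempty (H ≃* Multiplicative (Fin n → ℤ)) := by
  have : IsMulTorsionFree H := ⟨fun n hn x y h => by
    have h1 : (x / y) ^ n = 1 := by rw [div_pow, div_eq_one]; exact h
    exact div_eq_one.1 (htf _ n hn h1)⟩
  have : Module.Finite ℤ (Additive H) :=
    Module.Finite.iff_addGroup_fg.2 (GroupFG.iff_add_fg.1 inferInstance)
  have : Module.Free ℤ (Additive H) := Module.free_of_finite_type_torsion_free'
  exact ⟨_, ⟨(Module.finBasis ℤ (Additive H)).equivFun.toAddEquiv.toMultiplicativeRight⟩⟩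

/-- The Coxeter matrix of a set of generators. -/
def restrict {B : Type*} (M : CoxeterMatrix B) (T : Set B) : CoxeterMatrix T where
  M s t := M s t
  isSymm := by ext s t; exact M.symmetric t s
  diagonal s := M.diagonal s
  off_diagonal s t h := M.off_diagonal s t (Subtype.coe_injective.ne h)

lemma restrict_apply {B : Type*} (M : CoxeterMatrix B) (T : Set B) (s t : T) :
    restrict M T s t = M s t := rfl

/-- If `T` commutes with the remaining generators then it generates a Coxeter group with the
restricted Coxeter matrix. -/
lemma nonempty_coxeterSystem_closure {B : Type*} {M : CoxeterMatrix B} {W : Type*} [Group W]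
    (cs : CoxeterSystem M W) {T : Set B} (hT : ∀ s ∈ T, ∀ t ∉ T, M s t = 2) :
    Nonempty (CoxeterSystem (restrict M T) (Subgroup.closure (cs.simple '' T))) := by
  classical
  let cs' := (restrict M T).toCoxeterSystem
  let f : (restrict M T).Group →* W := cs'.lift ⟨fun s => cs.simple s, fun s t =>
    cs.simple_mul_simple_pow s t⟩
  have hf : ∀ s, f (cs'.simple s) = cs.simple s := cs'.lift_apply_simple _
  have hlift : M.IsLiftable fun s : B =>
      if h : s ∈ T then cs'.simple ⟨s, h⟩ else 1 := by
    intro s t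
    by_cases hs : s ∈ T <;> by_cases ht : t ∈ T
    · simp only [hs, ht, dite_true]
      exact cs'.simple_mul_simple_pow ⟨s, hs⟩ ⟨t, ht⟩
    · simp [hs, ht, hT s hs t ht]
    · simp [hs, ht, M.symmetric s t, hT t ht s hs]
    · simp [hs, ht]
  let g : W →* (restrict M T).Group := cs.lift ⟨_, hlift⟩
  have hg : ∀ s : T, g (cs.simple s) = cs'.simple s := fun s => by
    rw [cs.lift_apply_simple hlift]
    simp
  have hgf : g.comp f = MonoidHom.id _ := cs'.ext_simple fun s => by
    rw [MonoidHom.comp_apply, hf, hg, MonoidHom.id_apply]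
  have hinj : Function.Injective f :=
    Function.LeftInverse.injective (g := g) fun x => DFunLike.congr_fun hgf x
  have hrange : f.range = Subgroup.closure (cs.simple '' T) := by
    rw [MonoidHom.range_eq_map, ← cs'.subgroup_closure_range_simple, MonoidHom.map_closure,
      ← Set.range_comp]
    congr 1
    ext w
    simp [hf]
  exact ⟨⟨((MonoidHom.ofInjective hinj).trans (MulEquiv.subgroupCongr hrange)).symm⟩⟩

lemma connected_fromRel_reindex {B B' : Type*} (M : CoxeterMatrix B) (e : B ≃ B') :
    (SimpleGraph.fromRel fun s t => M.reindex e s t ≠ 2).Connected ↔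
      (SimpleGraph.fromRel fun s t => M s t ≠ 2).Connected := by
  refine (SimpleGraph.Iso.connected_iff ⟨e, fun {s t} => ?_⟩).symm
  simp [CoxeterMatrix.reindex_apply]

end Components

section Decomposition

variable {B : Type*} [Fintype B] [DecidableEq B] {M : CoxeterMatrix B}
  {W : Type*} [Group W]

lemma exists_finiteIndex_free_abelian (cs : CoxeterSystem M W)
    (hfree : ¬ ∃ f : FreeGroup (Fin 2) →* W, Function.Injective f) (G : Subgroup W)
    [Group.FG G] :
    ∃ (H : Subgroup G) (n : ℕ), H.FiniteIndex ∧
      Nonempty (H ≃* Multiplicative (Fin n → ℤ)) := by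
  have := finiteIndex_translations (cs := cs) hfree
  let H := (translations cs).subgroupOf G
  let : CommGroup H :=
    { (inferInstance : Group H) with
      mul_comm := fun x y => Subtype.ext (Subtype.ext
        (mul_comm_of_mem_translations (cs := cs) x.2 y.2)) }
  have hfg : Group.FG H := Subgroup.fg_of_index_ne_zero H
  obtain ⟨n, hn⟩ := exists_mulEquiv_multiplicative H fun x n hn hx =>
    Subtype.ext (Subtype.ext (eq_one_of_pow_eq_one (cs := cs) (n := n) x.2 hn
      (congrArg (fun z : H => ((z : G) : W)) hx)))
  exact ⟨H, n, inferInstance, hn⟩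

/-- A connected component of the Coxeter graph which generates an infinite group generates a
Euclidean simplex reflection group if there is no nonabelian free subgroup. -/
lemma isEuclideanSimplexGroup_closure (cs : CoxeterSystem M W)
    (hfree : ¬ ∃ f : FreeGroup (Fin 2) →* W, Function.Injective f)
    (C : (SimpleGraph.fromRel fun s t => M s t ≠ 2).ConnectedComponent)
    (hC : ∀ s ∈ C.supp, ∀ t ∉ C.supp, M s t = 2)
    [Infinite (Subgroup.closure (cs.simple '' C.supp))] :
    IsEuclideanSimplexGroup (Subgroup.closure (cs.simple '' C.supp)) := by
  obtain ⟨cs'⟩ := nonempty_coxeterSystem_closure cs hC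
  have hfin : Finite C.supp := inferInstance
  let e := Finite.equivFin C.supp
  refine ⟨inferInstance, ⟨_, inferInstance, (restrict M C.supp).reindex e, ⟨cs'.reindex e⟩, ?_⟩,
    exists_finiteIndex_free_abelian cs hfree _⟩
  have hgraph : (SimpleGraph.fromRel fun s t => restrict M C.supp s t ≠ 2) =
      (SimpleGraph.fromRel fun s t => M s t ≠ 2).induce C.supp := by
    ext s t
    simp [restrict_apply, Subtype.ext_iff]
  rw [connected_fromRel_reindex, hgraph]
  exact C.connected_toSimpleGraph

end Decomposition

end CoxeterGeom

/-- If `(W,S)` is a finitely generated Coxeter system with no nonabelian free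
subgroup, then `S` is a disjoint union of pairwise commuting subsets, each
generating either a finite group or a Euclidean simplex reflection group;
in particular `W` is virtually abelian. -/
theorem coxeter_no_free_subgroup_decomposition {B : Type*} [Finite B]
    {W : Type*} [Group W] (M : CoxeterMatrix B) (cs : CoxeterSystem M W)
    (hfree : ¬ ∃ f : FreeGroup (Fin 2) →* W, Function.Injective f) :
    (∃ (k : ℕ) (T : Fin k → Set B),
      (Pairwise fun i j => Disjoint (T i) (T j)) ∧
      (⋃ i, T i) = Set.univ ∧
      (∀ i j, i ≠ j → ∀ s ∈ T i, ∀ t ∈ T j,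
        Commute (cs.simple s) (cs.simple t)) ∧
      (∀ i, Finite (Subgroup.closure (cs.simple '' T i)) ∨
        IsEuclideanSimplexGroup (Subgroup.closure (cs.simple '' T i)))) ∧
    ∃ H : Subgroup W, H.FiniteIndex ∧ ∀ x ∈ H, ∀ y ∈ H, x * y = y * x := by
  classical
  have := Fintype.ofFinite B
  refine ⟨?_, CoxeterGeom.translations cs, CoxeterGeom.finiteIndex_translations hfree,
    fun x hx y hy => CoxeterGeom.mul_comm_of_mem_translations hx hy⟩
  let Γ := SimpleGraph.fromRel fun s t => M s t ≠ 2
  have hΓ : Finite Γ.ConnectedComponent := Quot.finite _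
  let e := Finite.equivFin Γ.ConnectedComponent
  have hcomm : ∀ C C' : Γ.ConnectedComponent, C ≠ C' → ∀ s ∈ C.supp, ∀ t ∈ C'.supp,
      M s t = 2 := by
    intro C C' hne s hs t ht
    by_contra h
    have hst : s ≠ t := by
      rintro rfl
      exact hne (hs.symm.trans ht)
    have hadj : Γ.Adj s t := (SimpleGraph.fromRel_adj _ _ _).2 ⟨hst, Or.inl h⟩
    exact hne (hs.symm.trans ((SimpleGraph.ConnectedComponent.sound hadj.reachable).trans ht))
  refine ⟨_, fun i => (e.symm i).supp, ?_, ?_, ?_, ?_⟩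
  · intro i j hij
    rw [Set.disjoint_left]
    exact fun s hi hj => hij (e.symm.injective (hi.symm.trans hj))
  · refine Set.eq_univ_of_forall fun s => Set.mem_iUnion.2 ⟨e (Γ.connectedComponentMk s), ?_⟩
    simp
  · intro i j hij s hs t ht
    have h2 := cs.simple_mul_simple_pow s t
    rw [hcomm _ _ (e.symm.injective.ne hij) s hs t ht, pow_two] at h2
    have h3 := eq_inv_of_mul_eq_one_left h2
    rwa [mul_inv_rev, cs.inv_simple, cs.inv_simple] at h3
  · intro i
    rcases finite_or_infinite (Subgroup.closure (cs.simple '' (e.symm i).supp)) with h | h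
    · exact Or.inl h
    · exact Or.inr (CoxeterGeom.isEuclideanSimplexGroup_closure cs hfree (e.symm i)
        fun s hs t ht => hcomm _ _ (fun h => ht h.symm) s hs t rfl)
end

section
/- Let (W,S) be a Coxeter system, A ⊆ S with ⟨A⟩ infinite, and suppose there is no nonempty F ⊆ A such that ⟨F⟩ is finite and ⟨A⟩ = ⟨A − F⟩ × ⟨F⟩. If w ∈ W and B ⊆ S satisfy w⟨A⟩w⁻¹ = ⟨B⟩, then A = B. -/
open Subgroup

namespace CoxeterMatrix

variable {S : Type*} (M : CoxeterMatrix S)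

/-- The vector along which the simple reflection `i` moves the dual geometric representation. -/
noncomputable def dualRoot (i : S) : S → ℝ := fun j ↦ -2 * Real.cos (Real.pi / M i j)

theorem proj_dualRoot_self (i : S) : (LinearMap.proj i : (S → ℝ) →ₗ[ℝ] ℝ) (M.dualRoot i) = 2 := by
  simp [dualRoot]

/-- The simple reflections of the dual geometric representation. -/
noncomputable def dualReflection (i : S) : (S → ℝ) ≃ₗ[ℝ] (S → ℝ) :=
  Module.reflection (M.proj_dualRoot_self i)

theorem dualReflection_apply (i : S) (v : S → ℝ) :
    M.dualReflection i v = v - v i • M.dualRoot i := by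
  simp [dualReflection, Module.reflection_apply]

theorem isLiftable_dualReflection : M.IsLiftable M.dualReflection := by
  intro i j
  obtain h0 | h1 | h2 | h3 : M i j = 0 ∨ M i j = 1 ∨ M i j = 2 ∨ 3 ≤ M i j := by omega
  · simp [h0]
  · have hij : i = j := by
      by_contra h
      exact M.off_diagonal i j h h1
    subst hij
    rw [h1, pow_one]
    exact LinearEquiv.ext fun v ↦ Module.involutive_reflection (M.proj_dualRoot_self i) v
  · have h2' : M j i = 2 := M.symmetric i j ▸ h2
    have hi := M.proj_dualRoot_self i
    have hj := M.proj_dualRoot_self j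
    simp only [LinearMap.proj_apply] at hi hj
    have hij : M.dualRoot i j = 0 := by simp [dualRoot, h2]
    have hji : M.dualRoot j i = 0 := by simp [dualRoot, h2']
    rw [h2]
    ext v k
    simp only [pow_two, LinearEquiv.mul_apply, dualReflection_apply, LinearEquiv.coe_one, id,
      Pi.sub_apply, Pi.smul_apply, smul_eq_mul, hij, hji, hi, hj]
    ring
  · set m := M i j with hm
    set φ : ℝ := 2 * (Real.pi / m) with hφ
    have hm0 : (m : ℝ) ≠ 0 := by positivity
    have hmφ : (m : ℝ) * φ = 2 * Real.pi := by rw [hφ]; field_simp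
    have hsin : Real.sin φ ≠ 0 := by
      refine (Real.sin_pos_of_pos_of_lt_pi (by positivity) ?_).ne'
      have : (3 : ℝ) ≤ m := by exact_mod_cast h3
      nlinarith [Real.pi_pos, mul_pos (by positivity : 0 < φ) (by positivity : (0 : ℝ) < m)]
    have ht : 2 * Real.cos φ = (LinearMap.proj i : (S → ℝ) →ₗ[ℝ] ℝ) (M.dualRoot j) *
        (LinearMap.proj j : (S → ℝ) →ₗ[ℝ] ℝ) (M.dualRoot i) - 2 := by
      simp only [LinearMap.proj_apply, dualRoot, M.symmetric j i, ← hm]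
      rw [hφ, Real.cos_two_mul]
      ring
    have key (n : ℤ) := Polynomial.Chebyshev.S_two_mul_real_cos φ n
    apply LinearEquiv.ext
    intro v
    refine (Module.reflection_mul_reflection_pow_apply (M.proj_dualRoot_self i)
      (M.proj_dualRoot_self j) m v (2 * Real.cos φ) ht).trans ?_
    obtain ⟨k, hk | hk⟩ := Nat.even_or_odd' m
    · have e1 : ((m : ℤ) - 2) / 2 = k - 1 := by omega
      have e2 : ((m : ℤ) - 1) / 2 = k - 1 := by omega
      have hS : (Polynomial.Chebyshev.S ℝ (k - 1)).eval (2 * Real.cos φ) = 0 := by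
        have := key (k - 1)
        have hkφ : ((k - 1 : ℤ) + 1 : ℝ) * φ = Real.pi := by
          rw [hk] at hmφ
          push_cast at hmφ ⊢
          linarith
        rw [hkφ, Real.sin_pi] at this
        exact (mul_eq_zero.mp this).resolve_right hsin
      rw [e1, e2, hS]
      simp
    · have e1 : ((m : ℤ) - 2) / 2 = k - 1 := by omega
      have e2 : ((m : ℤ) - 1) / 2 = k := by omega
      have e3 : ((m : ℤ) - 3) / 2 = k - 1 := by omega
      have e4 : (m : ℤ) / 2 = k := by omega
      have hS : (Polynomial.Chebyshev.S ℝ k).eval (2 * Real.cos φ) +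
          (Polynomial.Chebyshev.S ℝ (k - 1)).eval (2 * Real.cos φ) = 0 := by
        have h1 := key k
        have h2 := key (k - 1)
        have hkφ : ((k : ℤ) + 1 : ℝ) * φ = 2 * Real.pi - ((k - 1 : ℤ) + 1 : ℝ) * φ := by
          rw [hk] at hmφ
          push_cast at hmφ ⊢
          linarith
        rw [hkφ, Real.sin_two_pi_sub] at h1
        refine (mul_eq_zero.mp ?_).resolve_right hsin
        linear_combination h1 + h2
      rw [e1, e2, e3, e4, hS]
      simp

end CoxeterMatrix

namespace CoxeterSystem

variable {S W : Type*} [Group W] {M : CoxeterMatrix S} (cs : CoxeterSystem M W)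

/-- The dual geometric representation of a Coxeter group. -/
noncomputable def dualRep : W →* ((S → ℝ) ≃ₗ[ℝ] (S → ℝ)) :=
  cs.lift ⟨M.dualReflection, M.isLiftable_dualReflection⟩

theorem dualRep_simple (i : S) : cs.dualRep (cs.simple i) = M.dualReflection i :=
  cs.lift_apply_simple _ i

/-- The visual subgroup generated by the simple reflections in `J`. -/
abbrev visual (J : Set S) : Subgroup W := closure (cs.simple '' J)

theorem simple_mem_visual {J : Set S} {i : S} (hi : i ∈ J) : cs.simple i ∈ cs.visual J :=
  subset_closure ⟨i, hi, rfl⟩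

theorem simple_mem_visual_iff {J : Set S} {i : S} : cs.simple i ∈ cs.visual J ↔ i ∈ J := by
  classical
  refine ⟨fun h ↦ ?_, cs.simple_mem_visual⟩
  by_contra hi
  have fixed (u : W) (hu : u ∈ cs.visual J) :
      cs.dualRep u (Pi.single i 1) = Pi.single i 1 := by
    have hle : cs.visual J ≤ (MulAction.stabilizer ((S → ℝ) ≃ₗ[ℝ] (S → ℝ))
        (Pi.single i 1 : S → ℝ)).comap cs.dualRep := by
      rw [closure_le]
      rintro _ ⟨j, hj, rfl⟩
      have hji : j ≠ i := fun h ↦ hi (h ▸ hj)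
      change cs.dualRep (cs.simple j) (Pi.single i 1) = Pi.single i 1
      simp [dualRep_simple, CoxeterMatrix.dualReflection_apply, hji]
    exact hle hu
  have := congrFun (fixed _ h) i
  have hii := M.proj_dualRoot_self i
  simp only [LinearMap.proj_apply] at hii
  norm_num [dualRep_simple, CoxeterMatrix.dualReflection_apply, hii] at this

open Classical in
/-- The action of a simple reflection on signed elements of the group, changing the sign of the
reflection itself only. -/
noncomputable def signedConj (i : S) : Function.End (W × ZMod 2) := fun p ↦
  (cs.simple i * p.1 * cs.simple i, p.2 + if p.1 = cs.simple i then 1 else 0)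

theorem signedConj_mul_pow_apply (i j : S) (k : ℕ) (t : W) (ε : ZMod 2) [DecidableEq W] :
    ((cs.signedConj i * cs.signedConj j) ^ k) (t, ε) =
      ((cs.simple i * cs.simple j) ^ k * t * ((cs.simple i * cs.simple j) ^ k)⁻¹,
        ε + ∑ n ∈ Finset.range (2 * k),
          if t = cs.simple j * (cs.simple i * cs.simple j) ^ n then 1 else 0) := by
  induction k with
  | zero => simp; rfl
  | succ k ih =>
    rw [pow_succ']
    change cs.signedConj i (cs.signedConj j (((cs.signedConj i * cs.signedConj j) ^ k) (t, ε))) = _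
    rw [ih]
    set r := cs.simple i * cs.simple j with hr
    have hc (k : ℕ) : cs.simple j * r ^ k = (r ^ k)⁻¹ * cs.simple j := by
      have : cs.simple j * r * (cs.simple j)⁻¹ = r⁻¹ := by simp [hr, mul_assoc]
      rw [← inv_pow, ← this, conj_pow]
      simp [mul_assoc]
    have h1 : r ^ k * t * (r ^ k)⁻¹ = cs.simple j ↔ t = cs.simple j * r ^ (2 * k) := by
      rw [two_mul, pow_add, ← mul_assoc, hc, mul_inv_eq_iff_eq_mul, mul_assoc,
        eq_inv_mul_iff_mul_eq]
    have h2 : cs.simple j * (r ^ k * t * (r ^ k)⁻¹) * cs.simple j = cs.simple i ↔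
        t = cs.simple j * r ^ (2 * k + 1) := by
      have e : cs.simple j * r ^ (2 * k + 1) =
          (r ^ k)⁻¹ * (cs.simple j * cs.simple i * cs.simple j) * r ^ k := by
        rw [show 2 * k + 1 = k + 1 + k by ring, pow_add, pow_succ, ← mul_assoc, ← mul_assoc, hc, hr]
        simp only [mul_assoc]
      rw [e]
      constructor
      · intro h
        rw [← h]
        simp [mul_assoc]
      · rintro rfl
        simp [mul_assoc]
    simp only [signedConj, h1, h2, Prod.mk.injEq]
    constructor
    · simp [pow_succ', hr, mul_assoc]
    · rw [show 2 * (k + 1) = 2 * k + 1 + 1 by ring, Finset.sum_range_succ, Finset.sum_range_succ]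
      simp only [add_assoc]

theorem isLiftable_signedConj : M.IsLiftable cs.signedConj := by
  classical
  intro i j
  funext ⟨t, ε⟩
  rw [signedConj_mul_pow_apply, two_mul, Finset.sum_range_add]
  simp only [pow_add, simple_mul_simple_pow, one_mul, inv_one, mul_one]
  rw [CharTwo.add_self_eq_zero, add_zero]
  rfl

/-- The action of a Coxeter group on signed group elements. -/
noncomputable def signedConjHom : W →* Function.End (W × ZMod 2) :=
  cs.lift ⟨cs.signedConj, cs.isLiftable_signedConj⟩

theorem signedConjHom_simple (i : S) : cs.signedConjHom (cs.simple i) = cs.signedConj i :=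
  cs.lift_apply_simple _ i

/-- The parity with which `t` occurs in the right inversion sequence of any word for `w`. -/
noncomputable def inversionParity (w t : W) : ZMod 2 := (cs.signedConjHom w (t, 0)).2

theorem signedConjHom_apply (w t : W) (ε : ZMod 2) :
    cs.signedConjHom w (t, ε) = (w * t * w⁻¹, ε + cs.inversionParity w t) := by
  unfold inversionParity
  induction w using cs.simple_induction_left generalizing t ε with
  | one =>
    rw [map_one]
    change (t, ε) = (_, ε + 0)
    simp
  | mul_simple_left w i ih =>
    rw [map_mul]
    change cs.signedConjHom (cs.simple i) (cs.signedConjHom w (t, ε)) =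
      (_, ε + (cs.signedConjHom (cs.simple i) (cs.signedConjHom w (t, 0))).2)
    rw [ih t ε, ih t 0, signedConjHom_simple]
    simp [signedConj, mul_assoc, add_assoc]

theorem inversionParity_mul (x y t : W) :
    cs.inversionParity (x * y) t =
      cs.inversionParity y t + cs.inversionParity x (y * t * y⁻¹) := by
  have : cs.signedConjHom (x * y) (t, 0) = cs.signedConjHom x (cs.signedConjHom y (t, 0)) := by
    rw [map_mul]
    rfl
  rw [inversionParity, this, signedConjHom_apply, signedConjHom_apply]
  simp

@[simp]
theorem inversionParity_one (t : W) : cs.inversionParity 1 t = 0 := by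
  simpa using cs.inversionParity_mul 1 1 t

theorem inversionParity_simple_self (i : S) :
    cs.inversionParity (cs.simple i) (cs.simple i) = 1 := by
  simp [inversionParity, signedConjHom_simple, signedConj]

theorem inversionParity_simple_of_ne {i : S} {t : W} (h : t ≠ cs.simple i) :
    cs.inversionParity (cs.simple i) t = 0 := by
  simp [inversionParity, signedConjHom_simple, signedConj, h]

theorem mem_rightInvSeq_of_inversionParity_ne_zero (ω : List S) {t : W}
    (h : cs.inversionParity (cs.wordProd ω) t ≠ 0) : t ∈ cs.rightInvSeq ω := by
  induction ω with
  | nil => simp at h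
  | cons i ω ih =>
    rw [rightInvSeq, List.mem_cons]
    by_cases h' : cs.inversionParity (cs.wordProd ω) t = 0
    · left
      rw [wordProd_cons, inversionParity_mul, h', zero_add] at h
      have := not_imp_comm.mp cs.inversionParity_simple_of_ne h
      rw [← this]
      group
    · exact Or.inr (ih h')

theorem finite_setOf_inversionParity_ne_zero (w : W) :
    {t | cs.inversionParity w t ≠ 0}.Finite := by
  obtain ⟨ω, rfl⟩ := cs.wordProd_surjective w
  exact (cs.rightInvSeq ω).finite_toSet.subset
    fun t ↦ cs.mem_rightInvSeq_of_inversionParity_ne_zero ω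

theorem inversionParity_ne_zero_of_isRightDescent {w : W} {i : S} (h : cs.IsRightDescent w i) :
    cs.inversionParity w (cs.simple i) ≠ 0 := by
  intro h0
  have h1 : cs.inversionParity (w * cs.simple i) (cs.simple i) ≠ 0 := by
    rw [inversionParity_mul, inversionParity_simple_self]
    simp [h0]
  obtain ⟨ω, hω, hw⟩ := cs.exists_isReduced (w * cs.simple i)
  have := cs.isRightInversion_of_mem_rightInvSeq hω
    (cs.mem_rightInvSeq_of_inversionParity_ne_zero ω (hw ▸ h1))
  rw [← hw, isRightInversion_simple_iff_isRightDescent] at this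
  exact (cs.isRightDescent_iff_not_isRightDescent_mul.mp h) this

theorem mem_visual_of_inversionParity_ne_zero {J : Set S} {u : W} (hu : u ∈ cs.visual J) {t : W}
    (h : cs.inversionParity u t ≠ 0) : t ∈ cs.visual J := by
  induction hu using closure_induction generalizing t with
  | mem u hu =>
    obtain ⟨j, hj, rfl⟩ := hu
    rw [not_imp_comm.mp cs.inversionParity_simple_of_ne h]
    exact cs.simple_mem_visual hj
  | one => simp at h
  | mul x y hx hy ihx ihy =>
    rw [inversionParity_mul] at h
    by_cases h' : cs.inversionParity y t = 0
    · rw [h', zero_add] at h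
      have := mul_mem (mul_mem (inv_mem hy) (ihx h)) hy
      simpa [mul_assoc] using this
    · exact ihy h'
  | inv x hx ih =>
    have h0 := cs.inversionParity_mul x x⁻¹ t
    rw [mul_inv_cancel, inversionParity_one] at h0
    have h1 : cs.inversionParity x (x⁻¹ * t * x⁻¹⁻¹) ≠ 0 := by
      intro h1
      rw [h1, add_zero] at h0
      exact h h0.symm
    have := mul_mem (mul_mem hx (ih h1)) (inv_mem hx)
    simpa [mul_assoc] using this

theorem IsReduced.mem_of_wordProd_mem_visual {cs : CoxeterSystem M W} {J : Set S} {ω : List S}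
    (hω : cs.IsReduced ω) (h : cs.wordProd ω ∈ cs.visual J) : ∀ i ∈ ω, i ∈ J := by
  induction ω using List.reverseRecOn with
  | nil => simp
  | append_singleton ω i ih =>
    have hw : cs.wordProd (ω ++ [i]) = cs.wordProd ω * cs.simple i := by
      simp [wordProd_append]
    have hred : cs.IsReduced ω := by simpa using hω.take ω.length
    have hdesc : cs.IsRightDescent (cs.wordProd (ω ++ [i])) i := by
      rw [IsRightDescent, hω.eq, hw, simple_mul_simple_cancel_right, hred.eq]
      simp
    have hi : cs.simple i ∈ cs.visual J := cs.mem_visual_of_inversionParity_ne_zero h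
      (cs.inversionParity_ne_zero_of_isRightDescent hdesc)
    rw [hw] at h
    have := ih hred ((mul_mem_cancel_right hi).mp h)
    rw [cs.simple_mem_visual_iff] at hi
    simpa [or_imp, forall_and] using ⟨this, hi⟩

theorem disjoint_visual {J K : Set S} (h : Disjoint J K) : Disjoint (cs.visual J) (cs.visual K) := by
  rw [disjoint_def]
  intro x hJ hK
  obtain ⟨ω, hω, rfl⟩ := cs.exists_isReduced x
  have hJ' := hω.mem_of_wordProd_mem_visual hJ
  have hK' := hω.mem_of_wordProd_mem_visual hK
  have : ω = [] := List.eq_nil_iff_forall_not_mem.mpr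
    fun i hi ↦ Set.disjoint_left.mp h (hJ' i hi) (hK' i hi)
  simp [this]

theorem commute_of_conj_mem_visual {J : Set S} {n : W} {c : S} (hn : n ∈ cs.visual J)
    (hc : c ∉ J) (h : cs.simple c * n * cs.simple c ∈ cs.visual J) : Commute (cs.simple c) n := by
  have hcJ : cs.simple c ∉ cs.visual J := by rwa [simple_mem_visual_iff]
  set y := cs.simple c * n * cs.simple c with hy
  set t := n⁻¹ * cs.simple c * n with ht
  have htJ : t ∉ cs.visual J := fun hmem ↦ hcJ <| by
    simpa [ht, mul_assoc] using mul_mem (mul_mem hn hmem) (inv_mem hn)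
  have hctc : cs.simple c * t * (cs.simple c)⁻¹ ∉ cs.visual J := fun hmem ↦ htJ <| by
    simpa [hy, ht, mul_assoc] using
      mul_mem (mul_mem (mul_mem (mul_mem (inv_mem hn) h) hmem) (inv_mem h)) hn
  have e1 := cs.inversionParity_mul y (cs.simple c) t
  have e2 := cs.inversionParity_mul (cs.simple c) n t
  rw [not_imp_comm.mp (cs.mem_visual_of_inversionParity_ne_zero h) hctc, add_zero] at e1
  rw [not_imp_comm.mp (cs.mem_visual_of_inversionParity_ne_zero hn) htJ, zero_add,
    show n * t * n⁻¹ = cs.simple c by simp [ht, mul_assoc], inversionParity_simple_self] at e2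
  have hyc : y * cs.simple c = cs.simple c * n := by simp [hy]
  rw [hyc, e2] at e1
  have htc : t = cs.simple c := by
    by_contra hne
    rw [cs.inversionParity_simple_of_ne hne] at e1
    exact one_ne_zero e1
  rw [ht, mul_assoc, inv_mul_eq_iff_eq_mul] at htc
  exact htc

theorem commute_of_inversionParity_ne_zero {J : Set S} {n : W} {c j : S} (hn : n ∈ cs.visual J)
    (hc : c ∉ J) (h : Commute (cs.simple c) n) (hj : cs.inversionParity n (cs.simple j) ≠ 0) :
    Commute (cs.simple c) (cs.simple j) := by
  by_cases hjc : cs.simple j = cs.simple c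
  · rw [hjc]
  have hjJ := cs.mem_visual_of_inversionParity_ne_zero hn hj
  have e1 := cs.inversionParity_mul n (cs.simple c) (cs.simple j)
  have e2 := cs.inversionParity_mul (cs.simple c) n (cs.simple j)
  rw [cs.inversionParity_simple_of_ne hjc, zero_add, ← h.eq, e2,
    cs.inversionParity_simple_of_ne (t := n * cs.simple j * n⁻¹), add_zero, inv_simple] at e1
  · exact cs.commute_of_conj_mem_visual hjJ hc
      (cs.mem_visual_of_inversionParity_ne_zero hn (e1 ▸ hj))
  · intro h'
    rw [mul_inv_eq_iff_eq_mul, h.eq] at h'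
    exact hjc (mul_left_cancel h')

theorem IsReduced.commute_of_commute_wordProd {cs : CoxeterSystem M W} {J : Set S} {ω : List S}
    {c : S} (hω : cs.IsReduced ω) (hJ : cs.wordProd ω ∈ cs.visual J) (hc : c ∉ J)
    (h : Commute (cs.simple c) (cs.wordProd ω)) :
    ∀ j ∈ ω, Commute (cs.simple c) (cs.simple j) := by
  induction ω using List.reverseRecOn with
  | nil => simp
  | append_singleton ω i ih =>
    have hw : cs.wordProd (ω ++ [i]) = cs.wordProd ω * cs.simple i := by
      simp [wordProd_append]
    have hred : cs.IsReduced ω := by simpa using hω.take ω.length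
    have hdesc : cs.IsRightDescent (cs.wordProd (ω ++ [i])) i := by
      rw [IsRightDescent, hω.eq, hw, simple_mul_simple_cancel_right, hred.eq]
      simp
    have hpar := cs.inversionParity_ne_zero_of_isRightDescent hdesc
    have hi := cs.mem_visual_of_inversionParity_ne_zero hJ hpar
    have hci := cs.commute_of_inversionParity_ne_zero hJ hc h hpar
    have hw' : cs.wordProd ω = cs.wordProd (ω ++ [i]) * cs.simple i := by simp [hw]
    have := ih hred (hw' ▸ mul_mem hJ hi) (hw' ▸ h.mul_right hci)
    simpa [or_imp, forall_and] using ⟨this, hci⟩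

/-- The elements of `⟨A⟩` centralizing every `⟨A⟩`-conjugate of `s`. -/
def conjCentralizer (A : Set S) (s : S) : Subgroup W :=
  cs.visual A ⊓ centralizer {t | ∃ u ∈ cs.visual A, u * cs.simple s * u⁻¹ = t}

theorem conj_mem_conjCentralizer {A : Set S} {s : S} {n x : W} (hn : n ∈ cs.conjCentralizer A s)
    (hx : x ∈ cs.visual A) : x * n * x⁻¹ ∈ cs.conjCentralizer A s := by
  refine mem_inf.mpr ⟨mul_mem (mul_mem hx hn.1) (inv_mem hx), mem_centralizer_iff.mpr ?_⟩
  rintro _ ⟨u, hu, rfl⟩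
  have := mem_centralizer_iff.mp hn.2 _ ⟨x⁻¹ * u, mul_mem (inv_mem hx) hu, rfl⟩
  have := congrArg (fun z ↦ x * z * x⁻¹) this
  simpa [mul_assoc] using this

/-- If the conjugates of a simple reflection `s ∉ A` under `⟨A⟩` form a finite set, then `s`
commutes with `A` up to a finite direct factor of `⟨A⟩`. -/
theorem exists_finite_factor_of_finite_conj {A : Set S} {s : S} (hs : s ∉ A)
    (hfin : {t | ∃ u ∈ cs.visual A, u * cs.simple s * u⁻¹ = t}.Finite) :
    ∃ J ⊆ A, (∀ j ∈ J, Commute (cs.simple s) (cs.simple j)) ∧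
      (∀ c ∈ A \ J, ∀ j ∈ J, Commute (cs.simple c) (cs.simple j)) ∧
      Finite (cs.visual (A \ J)) := by
  set N := cs.conjCentralizer A s
  set J : Set S := {j | ∃ ω, cs.IsReduced ω ∧ cs.wordProd ω ∈ N ∧ j ∈ ω}
  have hJA : J ⊆ A := by
    rintro j ⟨ω, hω, hωN, hj⟩
    exact hω.mem_of_wordProd_mem_visual hωN.1 j hj
  have hNJ {n : W} (hn : n ∈ N) : n ∈ cs.visual J := by
    obtain ⟨ω, hω, rfl⟩ := cs.exists_isReduced n
    refine list_prod_mem fun x hx ↦ ?_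
    obtain ⟨j, hj, rfl⟩ := List.mem_map.mp hx
    exact cs.simple_mem_visual ⟨ω, hω, hn, hj⟩
  have comm {c : S} (hc : c ∉ J) (h : ∀ n ∈ N, Commute (cs.simple c) n) :
      ∀ j ∈ J, Commute (cs.simple c) (cs.simple j) := by
    rintro j ⟨ω, hω, hωN, hj⟩
    exact hω.commute_of_commute_wordProd (hNJ hωN) hc (h _ hωN) j hj
  refine ⟨J, hJA, comm (fun h ↦ hs (hJA h)) ?_, fun c hc ↦ comm hc.2 ?_, ?_⟩
  · intro n hn
    have := mem_centralizer_iff.mp hn.2 _ ⟨1, one_mem _, rfl⟩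
    simpa [commute_iff_eq] using this
  · intro n hn
    have := cs.conj_mem_conjCentralizer hn (cs.simple_mem_visual hc.1)
    rw [inv_simple] at this
    exact cs.commute_of_conj_mem_visual (hNJ hn) hc.2 (hNJ this)
  · have := hfin.to_subtype
    have hle : cs.visual (A \ J) ≤ cs.visual A := closure_mono (Set.image_mono Set.sdiff_subset)
    let act (x : cs.visual (A \ J))
        (t : {t | ∃ u ∈ cs.visual A, u * cs.simple s * u⁻¹ = t}) :
        {t | ∃ u ∈ cs.visual A, u * cs.simple s * u⁻¹ = t} :=
      ⟨x * t * (x : W)⁻¹, by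
        obtain ⟨t, u, hu, rfl⟩ := t
        exact ⟨x * u, mul_mem (hle x.2) hu, by simp [mul_assoc]⟩⟩
    refine Finite.of_injective act fun x y hxy ↦ ?_
    have hz : (x⁻¹ * y : W) ∈ cs.visual (A \ J) := mul_mem (inv_mem x.2) y.2
    have hzN : (x⁻¹ * y : W) ∈ N := by
      refine mem_inf.mpr ⟨hle hz, mem_centralizer_iff.mpr fun t ht ↦ ?_⟩
      have : (x : W) * t * (x : W)⁻¹ = y * t * (y : W)⁻¹ :=
        congrArg Subtype.val (congrFun hxy ⟨t, ht⟩)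
      have := congrArg (fun z ↦ (x : W)⁻¹ * z * y) this
      simpa [mul_assoc] using this
    have := disjoint_def.mp (cs.disjoint_visual Set.disjoint_sdiff_right) (hNJ hzN) hz
    exact Subtype.ext (inv_mul_eq_one.mp this)

/-- A simple reflection outside `A` which is a right descent of an element conjugating `⟨A⟩` to a
visual subgroup has only finitely many conjugates under `⟨A⟩`. -/
theorem finite_conj_of_isRightDescent {A B : Set S} {w : W} {s : S}
    (hconj : (cs.visual A).map (MulAut.conj w).toMonoidHom = cs.visual B) (hs : s ∉ A)
    (hdesc : cs.IsRightDescent w s) :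
    {t | ∃ u ∈ cs.visual A, u * cs.simple s * u⁻¹ = t}.Finite := by
  refine (cs.finite_setOf_inversionParity_ne_zero w).subset ?_
  rintro _ ⟨u, hu, rfl⟩
  have hsA : cs.simple s ∉ cs.visual A := by rwa [simple_mem_visual_iff]
  have hmem (x : W) : w * x * w⁻¹ ∈ cs.visual B ↔ x ∈ cs.visual A := by
    rw [← hconj]
    exact mem_map_iff_mem (MulAut.conj w).injective
  have e1 := cs.inversionParity_mul w u (cs.simple s)
  have e2 := cs.inversionParity_mul (w * u * w⁻¹) w (cs.simple s)
  rw [not_imp_comm.mp (cs.mem_visual_of_inversionParity_ne_zero hu) hsA, zero_add] at e1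
  rw [not_imp_comm.mp (cs.mem_visual_of_inversionParity_ne_zero ((hmem u).mpr hu))
    (mt (hmem _).mp hsA), add_zero, inv_mul_cancel_right, e1] at e2
  change cs.inversionParity w (u * cs.simple s * u⁻¹) ≠ 0
  rw [e2]
  exact cs.inversionParity_ne_zero_of_isRightDescent hdesc

end CoxeterSystem

/-- Deodhar rigidity: if `⟨A⟩` is an infinite visual subgroup of a Coxeter
system with no nonempty finite visual direct factor, and `w⟨A⟩w⁻¹ = ⟨B⟩` for
some `w ∈ W`, `B ⊆ S`, then `A = B`. -/
theorem deodhar_rigidity {S : Type*} {W : Type*} [Group W]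
    (M : CoxeterMatrix S) (cs : CoxeterSystem M W) (A B : Set S) (w : W)
    (hinf : Infinite (closure (cs.simple '' A)))
    (hnofactor : ¬ ∃ F : Set S, F ⊆ A ∧ F.Nonempty ∧
      Finite (closure (cs.simple '' F)) ∧
      (∀ f ∈ F, ∀ a ∈ A \ F, Commute (cs.simple f) (cs.simple a)) ∧
      closure (cs.simple '' (A \ F)) ⊔ closure (cs.simple '' F) =
        closure (cs.simple '' A) ∧
      closure (cs.simple '' (A \ F)) ⊓ closure (cs.simple '' F) = ⊥)
    (hconj : Subgroup.map (MulAut.conj w).toMonoidHom (closure (cs.simple '' A)) =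
      closure (cs.simple '' B)) :
    A = B := by
  induction hl : cs.length w using Nat.strong_induction_on generalizing w with
  | _ l ih =>
  by_cases hw : w = 1
  · subst hw
    have h : cs.visual A = cs.visual B := by
      refine Eq.trans ?_ hconj
      rw [map_one]
      exact (map_id _).symm
    ext i
    rw [← cs.simple_mem_visual_iff, h, cs.simple_mem_visual_iff]
  obtain ⟨s, hs⟩ := cs.exists_rightDescent_of_ne_one hw
  refine ih _ (hl ▸ hs) (w * cs.simple s) ?_ rfl
  rw [map_mul]
  change map ((MulAut.conj w).toMonoidHom.comp (MulAut.conj (cs.simple s)).toMonoidHom) _ = _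
  rw [← map_map]
  refine Eq.trans (congrArg _ ?_) hconj
  by_cases hsA : s ∈ A
  · exact conj_smul_eq_self_of_mem (cs.simple_mem_visual hsA)
  obtain ⟨J, hJA, hsJ, hcomm, hfin⟩ := cs.exists_finite_factor_of_finite_conj hsA
    (cs.finite_conj_of_isRightDescent hconj hsA hs)
  have hJ : A ⊆ J := by
    by_contra hne
    refine hnofactor ⟨A \ J, Set.sdiff_subset, Set.sdiff_nonempty.mpr hne, hfin, ?_, ?_, ?_⟩
    · intro f hf a ha
      exact hcomm f hf a (by simpa [ha.1] using ha.2)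
    · rw [← Subgroup.closure_union, ← Set.image_union, Set.sdiff_union_of_subset Set.sdiff_subset]
    · exact (cs.disjoint_visual Set.disjoint_sdiff_left).eq_bot
  rw [MonoidHom.map_closure]
  congr 1
  rw [Set.image_image]
  refine Set.image_congr fun a ha ↦ ?_
  change cs.simple s * cs.simple a * (cs.simple s)⁻¹ = _
  rw [(hsJ a (hJ ha)).eq, mul_inv_cancel_right]
end
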